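/- arXiv:2401.13353 — 2 statements merged into one kernel-verified Lean document; each statement's English description precedes it below -/
import Mathlib

section
/- For every integer m ≥ 2 there exist constants c_m > 0 and C_m > 0 such that for all sufficiently large N ∈ ℕ, there exists a set S_N ⊆ {1,…,N} with card(S_N) ≥ c_m N^{1/m} and ‖S_N‖_{Λ(2m)} ≤ C_m. -/
open Set MeasureTheory
open scoped BigOperators Real

noncomputable section

/-- The trigonometric polynomial `x ↦ Σ_{n} a_n e^{2πinx}` attached to a finitely
supported sequence `a : ℤ →₀ ℂ`. -/
def expSum (a : ℤ →₀ ℂ) (t : ℝ) : ℂ :=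
  ∑ n ∈ a.support, a n * Complex.exp (2 * Real.pi * Complex.I * (n : ℂ) * (t : ℂ))

/-- `A` satisfies the `Λ(p)` bound with constant `C`:
`‖Σ_{n∈A} a_n e^{2πinx}‖_{L^p([0,1])} ≤ C (Σ |a_n|²)^{1/2}` for every finitely supported
sequence `a` supported in `A`.  (Thus `‖A‖_{Λ(p)} ≤ C`.) -/
def HasLambdaBound (A : Set ℤ) (p C : ℝ) : Prop :=
  ∀ a : ℤ →₀ ℂ, (∀ n : ℤ, n ∉ A → a n = 0) →
    (∫ t in Set.Icc (0 : ℝ) 1, ‖expSum a t‖ ^ p) ^ (1 / p) ≤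
      C * (∑ n ∈ a.support, ‖a n‖ ^ 2) ^ (1 / 2 : ℝ)

/-- Orthogonality of the characters `t ↦ e^{2πikt}` on `[0, 1]`. -/
lemma integral_exp_two_pi_int_mul (k : ℤ) :
    ∫ t in (0 : ℝ)..1, Complex.exp (2 * Real.pi * Complex.I * (k : ℂ) * (t : ℂ)) =
      if k = 0 then 1 else 0 := by
  split_ifs with h
  · simp [h]
  · have hc : (2 * Real.pi * Complex.I * (k : ℂ)) ≠ 0 := by
      simp [Real.pi_ne_zero, h]
    rw [integral_exp_mul_complex hc]
    have : Complex.exp (2 * Real.pi * Complex.I * (k : ℂ)) = 1 :=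
      Complex.exp_eq_one_iff.2 ⟨k, by ring⟩
    simp [this]

/-- Parseval's identity for trigonometric polynomials. -/
lemma integral_norm_sq_trigSum (T : Finset ℤ) (b : ℤ → ℂ) :
    ∫ t in (0 : ℝ)..1,
        ‖∑ k ∈ T, b k * Complex.exp (2 * Real.pi * Complex.I * (k : ℂ) * (t : ℂ))‖ ^ 2 =
      ∑ k ∈ T, ‖b k‖ ^ 2 := by
  have key : ∀ t : ℝ,
      ((‖∑ k ∈ T, b k * Complex.exp (2 * Real.pi * Complex.I * (k : ℂ) * (t : ℂ))‖ ^ 2 : ℝ) : ℂ) =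
      ∑ k ∈ T, ∑ l ∈ T, (b k * (starRingEnd ℂ) (b l)) *
        Complex.exp (2 * Real.pi * Complex.I * ((k - l : ℤ) : ℂ) * (t : ℂ)) := by
    intro t
    rw [Complex.ofReal_pow, ← Complex.mul_conj', map_sum, Finset.sum_mul_sum]
    refine Finset.sum_congr rfl fun k _ => Finset.sum_congr rfl fun l _ => ?_
    rw [map_mul, ← Complex.exp_conj]
    have : Complex.exp (2 * Real.pi * Complex.I * ((k - l : ℤ) : ℂ) * (t : ℂ)) =
        Complex.exp (2 * Real.pi * Complex.I * (k : ℂ) * (t : ℂ)) *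
        Complex.exp ((starRingEnd ℂ) (2 * Real.pi * Complex.I * (l : ℂ) * (t : ℂ))) := by
      rw [← Complex.exp_add]
      congr 1
      simp only [map_mul, Complex.conj_ofReal, Complex.conj_I, map_ofNat, map_intCast]
      push_cast
      ring
    rw [this]
    ring
  apply Complex.ofReal_injective
  rw [← intervalIntegral.integral_ofReal]
  simp_rw [key]
  rw [intervalIntegral.integral_finsetSum
    fun k _ => Continuous.intervalIntegrable (by fun_prop) _ _, Complex.ofReal_sum]
  refine Finset.sum_congr rfl fun k hk => ?_
  rw [intervalIntegral.integral_finsetSum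
    fun l _ => Continuous.intervalIntegrable (by fun_prop) _ _]
  simp_rw [intervalIntegral.integral_const_mul, integral_exp_two_pi_int_mul, sub_eq_zero]
  simp [hk, Complex.mul_conj']

/-- If any two `m`-term sums over `A` that agree have the same entries, then `A` is a
`Λ(2m)` set. -/
lemma hasLambdaBound_of_sum_eq {m : ℕ} (hm : m ≠ 0) {A : Set ℤ}
    (hA : ∀ v w : Fin m → ℤ, (∀ i, v i ∈ A) → (∀ i, w i ∈ A) → ∑ i, v i = ∑ i, w i →
      ∀ i, v i ∈ Set.range w) :
    HasLambdaBound A (2 * m) (((m : ℝ) ^ m) ^ (1 / (2 * m : ℝ))) := by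
  intro a ha
  set P := Fintype.piFinset fun _ : Fin m => a.support with hP
  have hmemA : ∀ v ∈ P, ∀ i, v i ∈ A := fun v hv i => by
    by_contra h
    exact (Finsupp.mem_support_iff.1 (Fintype.mem_piFinset.1 hv i)) (ha _ h)
  obtain ⟨T, hmaps⟩ : ∃ T : Finset ℤ, ∀ v ∈ P, ∑ i, v i ∈ T :=
    ⟨P.image fun v => ∑ i, v i, fun v hv => Finset.mem_image.2 ⟨v, hv, rfl⟩⟩
  set b : ℤ → ℂ := fun k => ∑ v ∈ P with ∑ i, v i = k, ∏ i, a (v i) with hb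
  have hpow : ∀ t : ℝ, expSum a t ^ m =
      ∑ k ∈ T, b k * Complex.exp (2 * Real.pi * Complex.I * (k : ℂ) * (t : ℂ)) := by
    intro t
    have h1 : expSum a t ^ m = ∏ _i : Fin m, expSum a t := by simp
    rw [h1]
    unfold expSum
    rw [Finset.prod_univ_sum, ← hP,
      ← Finset.sum_fiberwise_of_maps_to hmaps]
    refine Finset.sum_congr rfl fun k _ => ?_
    rw [hb, Finset.sum_mul]
    refine Finset.sum_congr rfl fun v hv => ?_
    rw [Finset.prod_mul_distrib, ← Complex.exp_sum, ← (Finset.mem_filter.1 hv).2]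
    push_cast
    rw [Finset.mul_sum, Finset.sum_mul]
  have hcard : ∀ k, ((P.filter fun v => ∑ i, v i = k).card : ℝ) ≤ (m : ℝ) ^ m := by
    intro k
    rcases (P.filter fun v => ∑ i, v i = k).eq_empty_or_nonempty with h | ⟨w, hw⟩
    · rw [h]; simp
    · obtain ⟨hwP, hwk⟩ := Finset.mem_filter.1 hw
      have hsub : (P.filter fun v => ∑ i, v i = k) ⊆
          Fintype.piFinset fun _ : Fin m => Finset.univ.image w := by
        intro v hv
        obtain ⟨hvP, hvk⟩ := Finset.mem_filter.1 hv
        refine Fintype.mem_piFinset.2 fun i => ?_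
        simpa using hA v w (hmemA v hvP) (hmemA w hwP) (hvk.trans hwk.symm) i
      have h1 := Finset.card_le_card hsub
      rw [Fintype.card_piFinset_const] at h1
      have h2 : (Finset.univ.image w).card ≤ m := by
        simpa using Finset.card_image_le (s := Finset.univ) (f := w)
      exact_mod_cast h1.trans (Nat.pow_le_pow_left h2 m)
  have hbk : ∀ k, ‖b k‖ ^ 2 ≤
      (m : ℝ) ^ m * ∑ v ∈ P with ∑ i, v i = k, ∏ i, ‖a (v i)‖ ^ 2 := by
    intro k
    calc ‖b k‖ ^ 2 ≤ (∑ v ∈ P with ∑ i, v i = k, ‖∏ i, a (v i)‖) ^ 2 := by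
          gcongr
          exact norm_sum_le _ _
      _ ≤ _ := sq_sum_le_card_mul_sum_sq
      _ ≤ _ := by
          simp_rw [norm_prod, Finset.prod_pow]
          gcongr
          exact hcard k
  have hsum : ∑ k ∈ T, ‖b k‖ ^ 2 ≤ (m : ℝ) ^ m * (∑ n ∈ a.support, ‖a n‖ ^ 2) ^ m := by
    refine (Finset.sum_le_sum fun k _ => hbk k).trans_eq ?_
    rw [← Finset.mul_sum, Finset.sum_fiberwise_of_maps_to
      hmaps, hP,
      ← Finset.prod_univ_sum (fun _ => a.support) fun _ n => ‖a n‖ ^ 2]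
    simp
  have hint : ∫ t in Set.Icc (0 : ℝ) 1, ‖expSum a t‖ ^ (2 * m : ℝ) = ∑ k ∈ T, ‖b k‖ ^ 2 := by
    rw [← integral_norm_sq_trigSum, intervalIntegral.integral_of_le zero_le_one,
      integral_Icc_eq_integral_Ioc]
    congr 1
    ext t
    rw [← hpow, norm_pow, ← pow_mul, mul_comm m 2, ← Real.rpow_natCast]
    push_cast
    rfl
  have hm' : (m : ℝ) ≠ 0 := by exact_mod_cast hm
  have hE : 0 ≤ ∑ n ∈ a.support, ‖a n‖ ^ 2 := by positivity
  rw [hint]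
  refine (Real.rpow_le_rpow (by positivity) hsum (by positivity)).trans_eq ?_
  rw [Real.mul_rpow (by positivity) (by positivity)]
  congr 1
  rw [← Real.rpow_natCast (∑ n ∈ a.support, ‖a n‖ ^ 2), ← Real.rpow_mul hE]
  congr 1
  field_simp

open Polynomial in
/-- If `θ` has degree at least `m` over `F`, then the products `∏ i, (θ + u i)` of `m` factors
determine the set of values of `u`. -/
lemma mem_range_of_prod_add_algebraMap_eq {F K : Type*} [Field F] [Field K] [Algebra F K] {m : ℕ}
    {θ : K} (hθ : m ≤ (minpoly F θ).natDegree) {u v : Fin m → F}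
    (h : ∏ i, (θ + algebraMap F K (u i)) = ∏ i, (θ + algebraMap F K (v i))) (i : Fin m) :
    u i ∈ Set.range v := by
  have hdeg : ∀ w : Fin m → F, (∏ i, (X + C (w i))).degree = (m : WithBot ℕ) := fun w => by
    simp [degree_prod]
  have hmon : ∀ w : Fin m → F, (∏ i, (X + C (w i))).Monic := fun w =>
    monic_prod_of_monic _ _ fun i _ => monic_X_add_C _
  have heq : ∏ i, (X + C (u i)) = ∏ i, (X + C (v i)) := by
    by_contra hne
    have hlt := degree_sub_lt_left ((hdeg u).trans (hdeg v).symm) (hmon u).ne_zero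
      ((hmon u).leadingCoeff.trans (hmon v).leadingCoeff.symm)
    have hle := minpoly.degree_le_of_ne_zero F θ (sub_ne_zero.2 hne) (by
      simp [map_prod, h])
    have h1 : (m : WithBot ℕ) ≤ (minpoly F θ).degree := by
      have h0 : minpoly F θ ≠ 0 := fun h0 => by
        have : m = 0 := by simpa [h0] using hθ
        exact (this ▸ i).elim0
      rw [degree_eq_natDegree h0]
      exact_mod_cast hθ
    rw [hdeg u] at hlt
    exact absurd (h1.trans hle) (not_le.2 hlt)
  have h0 := congrArg (eval (-u i)) heq
  rw [eval_prod, eval_prod, Finset.prod_eq_zero (Finset.mem_univ i) (by simp)] at h0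
  obtain ⟨j, -, hj⟩ := Finset.prod_eq_zero_iff.1 h0.symm
  refine ⟨j, ?_⟩
  simp only [eval_add, eval_X, eval_C] at hj
  linear_combination hj

/-- The Bose–Chowla construction: `p` integers in `{1, …, p ^ m}` such that any two equal `m`-term
sums have the same entries. -/
lemma exists_boseChowla_set (p m : ℕ) [Fact p.Prime] (hm : 2 ≤ m) :
    ∃ S : Set ℤ, S ⊆ Set.Icc 1 ((p ^ m : ℕ) : ℤ) ∧ S.ncard = p ∧
      ∀ v w : Fin m → ℤ, (∀ i, v i ∈ S) → (∀ i, w i ∈ S) → ∑ i, v i = ∑ i, w i →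
        ∀ i, v i ∈ Set.range w := by
  have hm0 : m ≠ 0 := by omega
  let K := GaloisField p m
  obtain ⟨θ, hθ⟩ := Field.exists_primitive_element (ZMod p) K
  have hdeg : (minpoly (ZMod p) θ).natDegree = m := by
    rw [(Field.primitive_element_iff_minpoly_natDegree_eq (ZMod p) θ).1 hθ,
      GaloisField.finrank p hm0]
  have hne : ∀ a : ZMod p, θ + algebraMap (ZMod p) K a ≠ 0 := fun a h => by
    have h1 : θ = algebraMap (ZMod p) K (-a) := by
      rw [map_neg]
      exact eq_neg_of_add_eq_zero_left h
    rw [h1, minpoly.eq_X_sub_C, Polynomial.natDegree_X_sub_C] at hdeg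
    omega
  obtain ⟨g, hg⟩ := IsCyclic.exists_generator (α := Kˣ)
  have hlog : ∀ a : ZMod p, ∃ n < p ^ m, (g : K) ^ n = θ + algebraMap (ZMod p) K a := fun a => by
    classical
    obtain ⟨n, hn, hn'⟩ := Finset.mem_image.1
      (mem_zpowers_iff_mem_range_orderOf.1 (hg (Units.mk0 _ (hne a))))
    refine ⟨n, (Finset.mem_range.1 hn).trans_le ?_, ?_⟩
    · calc orderOf g ≤ Nat.card Kˣ := Nat.le_of_dvd Nat.card_pos (orderOf_dvd_natCard g)
        _ ≤ Nat.card K := Nat.card_le_card_of_injective _ Units.val_injective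
        _ = p ^ m := GaloisField.card p m hm0
    · simpa using congrArg Units.val hn'
  choose e he hge using hlog
  have hinj : Function.Injective fun a => (e a : ℤ) + 1 := fun a b hab => by
    have h1 : e a = e b := by simpa using hab
    have h2 := hge a
    rw [h1, hge b] at h2
    exact (algebraMap (ZMod p) K).injective (add_left_cancel h2).symm
  refine ⟨Set.range fun a => (e a : ℤ) + 1, ?_, ?_, ?_⟩
  · rintro _ ⟨a, rfl⟩
    have := he a
    simp only [Set.mem_Icc]
    omega
  · rw [← Set.image_univ, Set.ncard_image_of_injective _ hinj, Set.ncard_univ, Nat.card_zmod]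
  · intro v w hv hw hvw i
    choose a ha using hv
    choose b hb using hw
    have hsum : ∑ i, e (a i) = ∑ i, e (b i) := by
      simp_rw [← ha, ← hb, Finset.sum_add_distrib] at hvw
      exact_mod_cast add_right_cancel hvw
    have hprod : ∏ i, (θ + algebraMap (ZMod p) K (a i)) =
        ∏ i, (θ + algebraMap (ZMod p) K (b i)) := by
      simp_rw [← hge, Finset.prod_pow_eq_pow_sum, hsum]
    obtain ⟨j, hj⟩ := mem_range_of_prod_add_algebraMap_eq hdeg.ge hprod i
    exact ⟨j, by rw [← ha, ← hb, hj]⟩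

/-- For every integer `m ≥ 2` there are constants `c_m, C_m > 0` such that for all
sufficiently large `N` there exists `S_N ⊆ {1, …, N}` with `card(S_N) ≥ c_m N^{1/m}` and
`‖S_N‖_{Λ(2m)} ≤ C_m`. -/
theorem exists_large_lambda_two_m_set (m : ℕ) (hm : 2 ≤ m) :
    ∃ c C : ℝ, 0 < c ∧ 0 < C ∧ ∃ N₀ : ℕ, ∀ N : ℕ, N₀ ≤ N →
      ∃ S : Set ℤ, S ⊆ Set.Icc 1 (N : ℤ) ∧
        c * (N : ℝ) ^ (1 / (m : ℝ)) ≤ (S.ncard : ℝ) ∧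
        HasLambdaBound S (2 * m) C := by
  have hm0 : (m : ℝ) ≠ 0 := by positivity
  refine ⟨1 / 2, ((m : ℝ) ^ m) ^ (1 / (2 * m : ℝ)), by norm_num, by positivity, 2 ^ m,
    fun N hN => ?_⟩
  set x : ℝ := (N : ℝ) ^ (1 / (m : ℝ)) with hx
  have hx0 : 0 ≤ x := by positivity
  have hxm : x ^ m = N := by
    rw [hx, one_div, Real.rpow_inv_natCast_pow (by positivity) (by omega)]
  have hx2 : 2 ≤ x := by
    refine le_of_pow_le_pow_left₀ (by omega : m ≠ 0) hx0 ?_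
    rw [hxm]
    exact_mod_cast hN
  have hk : ⌊x / 2⌋₊ ≠ 0 := (Nat.floor_pos.2 (by linarith)).ne'
  obtain ⟨p, hp, hkp, hpk⟩ := Nat.exists_prime_lt_and_le_two_mul _ hk
  have : Fact p.Prime := ⟨hp⟩
  have hpx : (p : ℝ) ≤ x := by
    have h1 : (p : ℝ) ≤ 2 * (⌊x / 2⌋₊ : ℝ) := by exact_mod_cast hpk
    have h2 := Nat.floor_le (div_nonneg hx0 zero_le_two)
    linarith
  have hxp : x / 2 < p := (Nat.floor_lt' hp.ne_zero).1 hkp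
  have hpN : p ^ m ≤ N := by
    have : (p : ℝ) ^ m ≤ N := hxm ▸ pow_le_pow_left₀ (by positivity) hpx m
    exact_mod_cast this
  obtain ⟨S, hS, hcard, hsum⟩ := exists_boseChowla_set p m hm
  refine ⟨S, hS.trans (Set.Icc_subset_Icc_right (by exact_mod_cast hpN)), ?_,
    hasLambdaBound_of_sum_eq (by omega) hsum⟩
  rw [hcard]
  linarith
end
end

section
/- For every p > 2 there exist constants c_p > 0 and C_p > 0 such that for all sufficiently large N ∈ ℕ, there exists a set S_N ⊆ {1,…,N} with card(S_N) ≥ c_p N^{2/p} and ‖S_N‖_{Λ(p)} ≤ C_p. -/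
open Set MeasureTheory
open scoped BigOperators Real

noncomputable section

/-- The truncated weight `u ↦ min(1+u, M)^α`. -/
def truncWeight (α M u : ℝ) : ℝ := (min (1 + u) M) ^ α

/-- The primitive of `truncWeight` vanishing at `0`. -/
def truncPot (α M u : ℝ) : ℝ := ∫ s in (0 : ℝ)..u, truncWeight α M s

section TruncatedPotential

variable {α M : ℝ}

lemma continuous_truncWeight (hα : 0 < α) : Continuous (truncWeight α M) := by
  unfold truncWeight
  exact ((continuous_const.add continuous_id).min continuous_const).rpow_const
    (fun _ => Or.inr hα.le)

lemma continuous_truncPot (hα : 0 < α) : Continuous (truncPot α M) :=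
  intervalIntegral.continuous_primitive
    (fun _ _ => (continuous_truncWeight hα).intervalIntegrable _ _) 0

lemma one_le_truncWeight (hα : 0 < α) (hM : 1 ≤ M) {u : ℝ} (hu : 0 ≤ u) :
    1 ≤ truncWeight α M u :=
  Real.one_le_rpow (le_min (by linarith) hM) hα.le

lemma truncWeight_le (hα : 0 < α) (hM : 1 ≤ M) {u : ℝ} (hu : 0 ≤ u) :
    truncWeight α M u ≤ M ^ α :=
  Real.rpow_le_rpow (le_min (by linarith) (by linarith)) (min_le_right _ _) hα.le

lemma truncWeight_mono (hα : 0 < α) (hM : 1 ≤ M) {u v : ℝ} (hu : 0 ≤ u) (huv : u ≤ v) :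
    truncWeight α M u ≤ truncWeight α M v :=
  Real.rpow_le_rpow (le_min (by linarith) (by linarith))
    (min_le_min (by linarith) le_rfl) hα.le

lemma truncPot_sub_le (hα : 0 < α) (hM : 1 ≤ M) {u v : ℝ} (hu : 0 ≤ u) (hv : 0 ≤ v) :
    truncPot α M v - truncPot α M u ≤ (v - u) * truncWeight α M v := by
  have hi : ∀ a b : ℝ, IntervalIntegrable (truncWeight α M) volume a b :=
    fun a b => (continuous_truncWeight hα).intervalIntegrable a b
  have h : truncPot α M v - truncPot α M u = ∫ s in u..v, truncWeight α M s :=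
    intervalIntegral.integral_interval_sub_left (hi _ _) (hi _ _)
  rw [h]
  rcases le_total u v with huv | hvu
  · have := intervalIntegral.integral_mono_on huv (hi u v)
      (intervalIntegrable_const (c := truncWeight α M v))
      (fun s hs => truncWeight_mono hα hM (hu.trans hs.1) hs.2)
    simpa using this
  · have := intervalIntegral.integral_mono_on hvu
      (intervalIntegrable_const (c := truncWeight α M v)) (hi v u)
      (fun s hs => truncWeight_mono hα hM hv hs.1)
    rw [intervalIntegral.integral_symm]
    simp only [intervalIntegral.integral_const, smul_eq_mul] at this
    linarith

lemma truncPot_nonneg (hα : 0 < α) (hM : 1 ≤ M) {u : ℝ} (hu : 0 ≤ u) : 0 ≤ truncPot α M u :=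
  intervalIntegral.integral_nonneg hu
    (fun _ hs => zero_le_one.trans (one_le_truncWeight hα hM hs.1))

lemma mul_truncWeight_le (hα : 0 < α) (hM : 1 ≤ M) {u : ℝ} (hu : 0 ≤ u) :
    u * truncWeight α M u ≤ 2 ^ (α + 1) * truncPot α M u := by
  have h1 := truncPot_sub_le (v := u / 2) hα hM hu (by linarith)
  have h0 := truncPot_nonneg hα hM (u := u / 2) (by linarith)
  have h2 : truncWeight α M u ≤ 2 ^ α * truncWeight α M (u / 2) := by
    unfold truncWeight
    rw [← Real.mul_rpow (by norm_num) (le_min (by linarith) (by linarith))]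
    refine Real.rpow_le_rpow (le_min (by linarith) (by linarith)) ?_ hα.le
    rw [mul_min_of_nonneg _ _ (by norm_num : (0 : ℝ) ≤ 2)]
    exact min_le_min (by linarith) (by linarith)
  have h3 : (2 : ℝ) ^ (α + 1) = 2 ^ α * 2 := by
    rw [Real.rpow_add (by norm_num), Real.rpow_one]
  rw [h3]
  have h4 : (0 : ℝ) < 2 ^ α := by positivity
  calc u * truncWeight α M u ≤ u * (2 ^ α * truncWeight α M (u / 2)) := by gcongr
    _ = 2 ^ α * 2 * (u / 2 * truncWeight α M (u / 2)) := by ring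
    _ ≤ _ := by gcongr; linarith

lemma truncWeight_le_truncPot (hα : 0 < α) (hM : 1 ≤ M) {u : ℝ} (hu : 0 ≤ u) :
    truncWeight α M u ≤ 2 ^ (α + 1) * (1 + truncPot α M u) := by
  have h0 := truncPot_nonneg hα hM hu
  have h1 := mul_truncWeight_le hα hM hu
  have h2 := one_le_truncWeight hα hM hu
  have h4 : (0 : ℝ) < 2 ^ (α + 1) := by positivity
  rcases le_total u 1 with h | h
  · calc truncWeight α M u ≤ 2 ^ α :=
        Real.rpow_le_rpow (le_min (by linarith) (by linarith))
          ((min_le_left _ _).trans (by linarith)) hα.le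
      _ ≤ 2 ^ (α + 1) := Real.rpow_le_rpow_of_exponent_le (by norm_num) (by linarith)
      _ ≤ _ := by nlinarith
  · nlinarith

/-- The constant in the Lipschitz bound for `y ↦ y^α` near `1`. -/
def powLip (α : ℝ) : ℝ := ⌈α⌉₊ * 3 ^ ⌈α⌉₊

lemma abs_rpow_sub_one_le (hα : 0 < α) {y : ℝ} (hy : 0 < y) (hy3 : y ≤ 3) :
    |y ^ α - 1| ≤ powLip α * |y - 1| := by
  unfold powLip
  set k := ⌈α⌉₊ with hk
  have hαk : α ≤ k := Nat.le_ceil α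
  have h3k : (1 : ℝ) ≤ 3 ^ k := one_le_pow₀ (by norm_num)
  have hk0 : (0 : ℝ) ≤ k := Nat.cast_nonneg k
  rcases le_total 1 y with h | h
  · have h1 : (1 : ℝ) ≤ y ^ α := Real.one_le_rpow h hα.le
    rw [abs_of_nonneg (by linarith), abs_of_nonneg (by linarith)]
    have h2 : y ^ α ≤ y ^ k := by
      rw [← Real.rpow_natCast]; exact Real.rpow_le_rpow_of_exponent_le h hαk
    have h4 : ∀ m : ℕ, y ^ m - 1 ≤ m * 3 ^ m * (y - 1) := by
      intro m
      induction m with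
      | zero => simp
      | succ m ih =>
        have h5 : y ^ m ≤ 3 ^ m := pow_le_pow_left₀ hy.le hy3 m
        have h6 : (0 : ℝ) < 3 ^ m := by positivity
        have h7 : (0 : ℝ) ≤ m * 3 ^ m := by positivity
        push_cast
        rw [pow_succ, pow_succ]
        nlinarith [mul_nonneg h7 (sub_nonneg.2 h), mul_nonneg h6.le (sub_nonneg.2 h),
          mul_le_mul_of_nonneg_right h5 (sub_nonneg.2 h)]
    linarith [h4 k]
  · have h1 : y ^ α ≤ 1 := Real.rpow_le_one hy.le h hα.le
    rw [abs_of_nonpos (by linarith), abs_of_nonpos (by linarith)]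
    have h2 : y ^ k ≤ y ^ α := by
      rw [← Real.rpow_natCast]; exact Real.rpow_le_rpow_of_exponent_ge hy h hαk
    have h4 := one_add_mul_le_pow (a := y - 1) (by linarith) k
    rw [add_sub_cancel] at h4
    have h5 : (k : ℝ) * (1 - y) ≤ k * 3 ^ k * (1 - y) := by
      apply mul_le_mul_of_nonneg_right _ (by linarith)
      nlinarith
    linarith

lemma abs_truncWeight_sub_le (hα : 0 < α) (hM : 1 ≤ M) {u v : ℝ} (hu : 0 ≤ u) (hv : 0 ≤ v)
    (h : v - u ≤ 2 * (1 + u)) :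
    |truncWeight α M v - truncWeight α M u| ≤
      powLip α * truncWeight α M u * (|v - u| / (1 + u)) := by
  have hx : 0 < min (1 + u) M := lt_min (by linarith) (by linarith)
  have hx' : 0 < min (1 + v) M := lt_min (by linarith) (by linarith)
  set x := min (1 + u) M with hxd
  set x' := min (1 + v) M with hxd'
  have hratio : |x' / x - 1| ≤ |v - u| / (1 + u) := by
    rw [div_sub_one hx.ne', abs_div, abs_of_pos hx, div_le_div_iff₀ hx (by linarith)]
    rcases le_total u v with huv | hvu
    · have : x ≤ x' := min_le_min (by linarith) le_rfl
      rw [abs_of_nonneg (by linarith), abs_of_nonneg (by linarith)]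
      rcases le_total (1 + u) M with h1 | h1
      · rw [min_eq_left h1] at hxd
        have : x' ≤ 1 + v := min_le_left _ _
        rw [hxd]
        exact mul_le_mul_of_nonneg_right (by linarith) (by linarith)
      · have : x' = x := by
          rw [hxd, hxd', min_eq_right h1, min_eq_right (by linarith)]
        rw [this, sub_self, zero_mul]
        exact mul_nonneg (by linarith) hx.le
    · have : x' ≤ x := min_le_min (by linarith) le_rfl
      rw [abs_of_nonpos (by linarith), abs_of_nonpos (by linarith)]
      rcases le_total (1 + v) M with h1 | h1
      · rw [min_eq_left h1] at hxd'
        have h2 : x ≤ 1 + u := min_le_left _ _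
        rw [hxd']
        nlinarith
      · have : x' = x := by
          rw [hxd, hxd', min_eq_right h1, min_eq_right (by linarith)]
        rw [this, sub_self, neg_zero, zero_mul]
        exact mul_nonneg (by linarith) hx.le
  have h3 : x' / x ≤ 3 := by
    rw [div_le_iff₀ hx, hxd, mul_min_of_nonneg _ _ (by norm_num : (0 : ℝ) ≤ 3)]
    exact min_le_min (by linarith) (by linarith)
  have h4 := abs_rpow_sub_one_le hα (div_pos hx' hx) h3
  have hρ : 0 < x ^ α := Real.rpow_pos_of_pos hx α
  have hL : 0 ≤ powLip α := by unfold powLip; positivity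
  have h5 : x' ^ α - x ^ α = x ^ α * ((x' / x) ^ α - 1) := by
    rw [Real.div_rpow hx'.le hx.le]; field_simp
  change |x' ^ α - x ^ α| ≤ powLip α * x ^ α * _
  rw [h5, abs_mul, abs_of_pos hρ]
  calc x ^ α * |(x' / x) ^ α - 1| ≤ x ^ α * (powLip α * |x' / x - 1|) := by gcongr
    _ ≤ x ^ α * (powLip α * (|v - u| / (1 + u))) := by gcongr
    _ = _ := by ring

/-- Second-order upper bound for the potential `z ↦ truncPot (‖z‖²)`. -/
lemma truncPot_add_le (hα : 0 < α) (hM : 1 ≤ M) (z w : ℂ) (hw : ‖w‖ ≤ 1) :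
    truncPot α M (‖z + w‖ ^ 2) ≤ truncPot α M (‖z‖ ^ 2)
      + 2 * truncWeight α M (‖z‖ ^ 2) * (z * (starRingEnd ℂ) w).re
      + (1 + 5 * powLip α) * ‖w‖ ^ 2 * truncWeight α M (‖z‖ ^ 2) := by
  have hu : 0 ≤ ‖z‖ ^ 2 := by positivity
  have hu' : 0 ≤ ‖z + w‖ ^ 2 := by positivity
  have hexp : ‖z + w‖ ^ 2 - ‖z‖ ^ 2 = 2 * (z * (starRingEnd ℂ) w).re + ‖w‖ ^ 2 := by
    rw [← Complex.normSq_eq_norm_sq, ← Complex.normSq_eq_norm_sq, ← Complex.normSq_eq_norm_sq,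
      Complex.normSq_add]
    ring
  have hre : |(z * (starRingEnd ℂ) w).re| ≤ ‖z‖ * ‖w‖ := by
    simpa using Complex.abs_re_le_norm (z * (starRingEnd ℂ) w)
  have hz := norm_nonneg z
  have hw0 := norm_nonneg w
  have hL : 0 ≤ powLip α := by unfold powLip; positivity
  have h1 := truncPot_sub_le hα hM hu hu'
  set u := ‖z‖ ^ 2 with hud
  set v := ‖z + w‖ ^ 2 with hvd
  have habs : |v - u| ≤ ‖w‖ * (2 * ‖z‖ + 1) := by
    rw [hexp]
    refine (abs_add_le _ _).trans ?_
    rw [abs_mul, abs_of_nonneg (by norm_num : (0 : ℝ) ≤ 2), abs_of_nonneg (sq_nonneg ‖w‖)]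
    nlinarith
  have hle : v - u ≤ 2 * (1 + u) := by
    refine (le_abs_self _).trans (habs.trans ?_)
    nlinarith [sq_nonneg (‖z‖ - 1), mul_le_mul_of_nonneg_right hw (by linarith : 0 ≤ 2 * ‖z‖ + 1)]
  have h2 := abs_truncWeight_sub_le hα hM hu hu' hle
  have hρ : 0 ≤ truncWeight α M u := zero_le_one.trans (one_le_truncWeight hα hM hu)
  have h3 : (v - u) * truncWeight α M v ≤
      (v - u) * truncWeight α M u + |v - u| * (powLip α * truncWeight α M u *
        (|v - u| / (1 + u))) := by
    have : (v - u) * (truncWeight α M v - truncWeight α M u) ≤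
        |v - u| * (powLip α * truncWeight α M u * (|v - u| / (1 + u))) := by
      refine (le_abs_self _).trans ?_
      rw [abs_mul]; gcongr
    linarith
  have h4 : |v - u| * (|v - u| / (1 + u)) ≤ 5 * ‖w‖ ^ 2 := by
    rw [mul_div_assoc', div_le_iff₀ (by linarith)]
    calc |v - u| * |v - u| ≤ (‖w‖ * (2 * ‖z‖ + 1)) * (‖w‖ * (2 * ‖z‖ + 1)) := by gcongr
      _ = ‖w‖ ^ 2 * (2 * ‖z‖ + 1) ^ 2 := by ring
      _ ≤ ‖w‖ ^ 2 * (5 * (1 + u)) := by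
        gcongr
        nlinarith [sq_nonneg (‖z‖ - 2)]
      _ = _ := by ring
  have h5 : |v - u| * (powLip α * truncWeight α M u * (|v - u| / (1 + u))) ≤
      powLip α * truncWeight α M u * (5 * ‖w‖ ^ 2) := by
    calc _ = powLip α * truncWeight α M u * (|v - u| * (|v - u| / (1 + u))) := by ring
      _ ≤ _ := by gcongr
  have h6 : (v - u) * truncWeight α M u =
      2 * truncWeight α M u * (z * (starRingEnd ℂ) w).re + ‖w‖ ^ 2 * truncWeight α M u := by
    rw [hexp]; ring
  nlinarith

end TruncatedPotential

/-- The character `t ↦ e^{2πixt}`. -/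
def expo (x : ℤ) (t : ℝ) : ℂ := Complex.exp (2 * Real.pi * Complex.I * (x : ℂ) * (t : ℂ))

/-- The Fourier coefficient of `f` over the unit interval. -/
def trigCoeff (f : ℝ → ℂ) (x : ℤ) : ℂ := ∫ t in (0 : ℝ)..1, f t * (starRingEnd ℂ) (expo x t)

section Characters

lemma expo_eq (x : ℤ) (t : ℝ) : expo x t = Complex.exp ((2 * Real.pi * x * t : ℝ) * Complex.I) := by
  unfold expo; congr 1; push_cast; ring

lemma norm_expo (x : ℤ) (t : ℝ) : ‖expo x t‖ = 1 := by
  rw [expo_eq, Complex.norm_exp_ofReal_mul_I]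

lemma continuous_expo (x : ℤ) : Continuous (expo x) := by unfold expo; fun_prop

lemma conj_expo (x : ℤ) (t : ℝ) : (starRingEnd ℂ) (expo x t) = expo x (-t) := by
  rw [expo_eq, expo_eq, ← Complex.exp_conj, map_mul, Complex.conj_ofReal, Complex.conj_I]
  congr 1; push_cast; ring

lemma expo_add (x : ℤ) (s t : ℝ) : expo x (s + t) = expo x s * expo x t := by
  unfold expo; rw [← Complex.exp_add]; congr 1; push_cast; ring

lemma expo_mul_conj (x y : ℤ) (t : ℝ) :
    expo x t * (starRingEnd ℂ) (expo y t) = expo (x - y) t := by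
  rw [conj_expo]; unfold expo; rw [← Complex.exp_add]; congr 1; push_cast; ring

lemma integral_expo (x : ℤ) : ∫ t in (0 : ℝ)..1, expo x t = if x = 0 then 1 else 0 := by
  split_ifs with h
  · subst h; simp [expo]
  · have hc : (2 * Real.pi * Complex.I * (x : ℂ)) ≠ 0 := by
      simp [h, Real.pi_ne_zero, Complex.I_ne_zero]
    unfold expo
    rw [integral_exp_mul_complex hc]
    have : Complex.exp (2 * Real.pi * Complex.I * (x : ℂ) * ((1 : ℝ) : ℂ)) = 1 := by
      rw [Complex.exp_eq_one_iff]; exact ⟨x, by push_cast; ring⟩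
    rw [this]; simp

lemma integral_mul_conj_expo_sum {f : ℝ → ℂ} (hf : Continuous f) (T : Finset ℤ) (c : ℤ → ℂ) :
    ∫ t in (0 : ℝ)..1, f t * (starRingEnd ℂ) (∑ x ∈ T, c x * expo x t) =
      ∑ x ∈ T, (starRingEnd ℂ) (c x) * trigCoeff f x := by
  unfold trigCoeff
  simp_rw [← intervalIntegral.integral_const_mul]
  rw [← intervalIntegral.integral_finsetSum]
  · refine intervalIntegral.integral_congr fun t _ => ?_
    simp only [map_sum, map_mul, Finset.mul_sum]
    exact Finset.sum_congr rfl fun x _ => by ring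
  · intro x _
    have := continuous_expo x
    exact Continuous.intervalIntegrable (by fun_prop) _ _

lemma trigCoeff_sum (T : Finset ℤ) (c : ℤ → ℂ) {y : ℤ} (hy : y ∈ T) :
    trigCoeff (fun t => ∑ x ∈ T, c x * expo x t) y = c y := by
  unfold trigCoeff
  simp_rw [Finset.sum_mul, mul_assoc, expo_mul_conj]
  rw [intervalIntegral.integral_finsetSum]
  · simp_rw [intervalIntegral.integral_const_mul, integral_expo, sub_eq_zero]
    simp [hy]
  · intro x _
    have := continuous_expo (x - y)
    exact Continuous.intervalIntegrable (by fun_prop) _ _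

lemma bessel_trigCoeff {f : ℝ → ℂ} (hf : Continuous f) (T : Finset ℤ) :
    ∑ x ∈ T, ‖trigCoeff f x‖ ^ 2 ≤ ∫ t in (0 : ℝ)..1, ‖f t‖ ^ 2 := by
  set c := trigCoeff f with hc
  set P : ℝ → ℂ := fun t => ∑ x ∈ T, c x * expo x t with hP
  have hPc : Continuous P := by
    have := continuous_expo
    fun_prop
  have h1 : ∫ t in (0 : ℝ)..1, f t * (starRingEnd ℂ) (P t) = ((∑ x ∈ T, ‖c x‖ ^ 2 : ℝ) : ℂ) := by
    rw [integral_mul_conj_expo_sum hf]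
    push_cast
    exact Finset.sum_congr rfl fun x _ => by rw [← hc, Complex.conj_mul']
  have h2 : ∫ t in (0 : ℝ)..1, P t * (starRingEnd ℂ) (P t) = ((∑ x ∈ T, ‖c x‖ ^ 2 : ℝ) : ℂ) := by
    rw [integral_mul_conj_expo_sum hPc]
    push_cast
    refine Finset.sum_congr rfl fun x hx => ?_
    rw [trigCoeff_sum T c hx, Complex.conj_mul']
  have h1r : ∫ t in (0 : ℝ)..1, (f t * (starRingEnd ℂ) (P t)).re = ∑ x ∈ T, ‖c x‖ ^ 2 := by
    have := intervalIntegral.intervalIntegral_re (𝕜 := ℂ) (μ := volume) (a := 0) (b := 1)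
      (f := fun t => f t * (starRingEnd ℂ) (P t))
      (Continuous.intervalIntegrable (by fun_prop) _ _)
    simp only [RCLike.re_to_complex] at this
    rw [this, h1, Complex.ofReal_re]
  have h2r : ∫ t in (0 : ℝ)..1, ‖P t‖ ^ 2 = ∑ x ∈ T, ‖c x‖ ^ 2 := by
    have h3 : ∀ t, P t * (starRingEnd ℂ) (P t) = ((‖P t‖ ^ 2 : ℝ) : ℂ) := fun t => by
      rw [Complex.mul_conj']; push_cast; rfl
    simp_rw [h3] at h2
    rw [intervalIntegral.integral_ofReal] at h2
    exact_mod_cast h2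
  have h4 : ∫ t in (0 : ℝ)..1, (2 * (f t * (starRingEnd ℂ) (P t)).re - ‖P t‖ ^ 2) ≤
      ∫ t in (0 : ℝ)..1, ‖f t‖ ^ 2 := by
    refine intervalIntegral.integral_mono_on zero_le_one
      (Continuous.intervalIntegrable (by fun_prop) _ _)
      (Continuous.intervalIntegrable (by fun_prop) _ _) fun t _ => ?_
    have := sq_nonneg ‖f t - P t‖
    rw [← Complex.normSq_eq_norm_sq, Complex.normSq_sub] at this
    rw [← Complex.normSq_eq_norm_sq, ← Complex.normSq_eq_norm_sq]
    linarith
  rw [intervalIntegral.integral_sub (Continuous.intervalIntegrable (by fun_prop) _ _)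
      (Continuous.intervalIntegrable (by fun_prop) _ _),
    intervalIntegral.integral_const_mul, h1r, h2r] at h4
  linarith

end Characters

section Potential

variable {α M : ℝ}

/-- The integrated truncated potential. -/
def potInt (α M : ℝ) (f : ℝ → ℂ) : ℝ := ∫ t in (0 : ℝ)..1, truncPot α M (‖f t‖ ^ 2)

/-- The gradient field of `potInt`. -/
def potGrad (α M : ℝ) (f : ℝ → ℂ) (t : ℝ) : ℂ := (truncWeight α M (‖f t‖ ^ 2) : ℂ) * f t

/-- The growth rate of `potInt` when one character is added. -/
def potRate (α : ℝ) : ℝ := 2 + (1 + 5 * powLip α) * 2 ^ (α + 1)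

lemma potRate_pos : 0 < potRate α := by unfold potRate powLip; positivity

lemma continuous_potGrad (hα : 0 < α) {f : ℝ → ℂ} (hf : Continuous f) :
    Continuous (potGrad α M f) := by
  have := continuous_truncWeight (M := M) hα
  unfold potGrad
  fun_prop

lemma potInt_nonneg (hα : 0 < α) (hM : 1 ≤ M) (f : ℝ → ℂ) : 0 ≤ potInt α M f :=
  intervalIntegral.integral_nonneg zero_le_one fun _ _ => truncPot_nonneg hα hM (by positivity)

lemma integral_sq_mul_truncWeight_le (hα : 0 < α) (hM : 1 ≤ M) {f : ℝ → ℂ} (hf : Continuous f) :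
    ∫ t in (0 : ℝ)..1, ‖f t‖ ^ 2 * truncWeight α M (‖f t‖ ^ 2) ≤
      2 ^ (α + 1) * potInt α M f := by
  have h1 := continuous_truncWeight (M := M) hα
  have h2 := continuous_truncPot (M := M) hα
  unfold potInt
  rw [← intervalIntegral.integral_const_mul]
  exact intervalIntegral.integral_mono_on zero_le_one
    (Continuous.intervalIntegrable (by fun_prop) _ _)
    (Continuous.intervalIntegrable (by fun_prop) _ _)
    fun t _ => mul_truncWeight_le hα hM (by positivity)

lemma sum_trigCoeff_potGrad_le (hα : 0 < α) (hM : 1 ≤ M) {f : ℝ → ℂ} (hf : Continuous f)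
    (T : Finset ℤ) :
    ∑ x ∈ T, ‖trigCoeff (potGrad α M f) x‖ ^ 2 ≤ M ^ α * (2 ^ (α + 1) * potInt α M f) := by
  have h1 := continuous_truncWeight (M := M) hα
  have h2 := continuous_potGrad (M := M) hα hf
  refine (bessel_trigCoeff h2 T).trans ?_
  refine le_trans ?_ (mul_le_mul_of_nonneg_left (integral_sq_mul_truncWeight_le hα hM hf)
    (by positivity))
  rw [← intervalIntegral.integral_const_mul]
  refine intervalIntegral.integral_mono_on zero_le_one
    (Continuous.intervalIntegrable (by fun_prop) _ _)
    (Continuous.intervalIntegrable (by fun_prop) _ _) fun t _ => ?_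
  have h3 := one_le_truncWeight hα hM (u := ‖f t‖ ^ 2) (by positivity)
  have h4 := truncWeight_le hα hM (u := ‖f t‖ ^ 2) (by positivity)
  unfold potGrad
  rw [norm_mul, Complex.norm_real, Real.norm_of_nonneg (by linarith), mul_pow, sq (truncWeight _ _ _)]
  calc _ = truncWeight α M (‖f t‖ ^ 2) * (‖f t‖ ^ 2 * truncWeight α M (‖f t‖ ^ 2)) := by ring
    _ ≤ _ := by gcongr

lemma potInt_add_expo_le (hα : 0 < α) (hM : 1 ≤ M) {f : ℝ → ℂ} (hf : Continuous f) {b : ℝ}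
    (hb : 0 ≤ b) (hb1 : b ≤ 1) {x : ℤ} (hx : ‖trigCoeff (potGrad α M f) x‖ ≤ b) :
    1 + potInt α M (fun t => f t + b * expo x t) ≤
      (1 + potInt α M f) * Real.exp (potRate α * b ^ 2) := by
  have h1 := continuous_truncWeight (M := M) hα
  have h2 := continuous_truncPot (M := M) hα
  have h3 := continuous_potGrad (M := M) hα hf
  have he := continuous_expo x
  have hG := potInt_nonneg hα hM f
  have hL : 0 ≤ powLip α := by unfold powLip; positivity
  set g := potGrad α M f with hg
  have hstep : potInt α M (fun t => f t + b * expo x t) ≤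
      ∫ t in (0 : ℝ)..1, (truncPot α M (‖f t‖ ^ 2) + 2 * b * (g t * (starRingEnd ℂ) (expo x t)).re
        + (1 + 5 * powLip α) * b ^ 2 * truncWeight α M (‖f t‖ ^ 2)) := by
    refine intervalIntegral.integral_mono_on zero_le_one
      (Continuous.intervalIntegrable (by fun_prop) _ _)
      (Continuous.intervalIntegrable (by fun_prop) _ _) fun t _ => ?_
    have hn : ‖(b : ℂ) * expo x t‖ = b := by
      rw [norm_mul, norm_expo, Complex.norm_real, Real.norm_of_nonneg hb, mul_one]
    have := truncPot_add_le hα hM (f t) (b * expo x t) (by rw [hn]; exact hb1)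
    rw [hn] at this
    refine this.trans (le_of_eq ?_)
    simp only [hg, potGrad, map_mul, Complex.conj_ofReal]
    rw [show (f t * ((b : ℂ) * (starRingEnd ℂ) (expo x t))) =
      (b : ℂ) * (f t * (starRingEnd ℂ) (expo x t)) by ring, mul_assoc (_ : ℂ) (f t),
      Complex.re_ofReal_mul, Complex.re_ofReal_mul]
    ring
  have hre : ∫ t in (0 : ℝ)..1, (g t * (starRingEnd ℂ) (expo x t)).re ≤ b := by
    have := intervalIntegral.intervalIntegral_re (𝕜 := ℂ) (μ := volume) (a := 0) (b := 1)
      (f := fun t => g t * (starRingEnd ℂ) (expo x t))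
      (Continuous.intervalIntegrable (by fun_prop) _ _)
    simp only [RCLike.re_to_complex] at this
    rw [this]
    exact (Complex.re_le_norm _).trans hx
  have hw : ∫ t in (0 : ℝ)..1, truncWeight α M (‖f t‖ ^ 2) ≤
      2 ^ (α + 1) * (1 + potInt α M f) := by
    have : (1 + potInt α M f) = ∫ t in (0 : ℝ)..1, (1 + truncPot α M (‖f t‖ ^ 2)) := by
      rw [intervalIntegral.integral_add (by simp)
        (Continuous.intervalIntegrable (by fun_prop) _ _)]
      simp [potInt]
    rw [this, ← intervalIntegral.integral_const_mul]
    exact intervalIntegral.integral_mono_on zero_le_one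
      (Continuous.intervalIntegrable (by fun_prop) _ _)
      (Continuous.intervalIntegrable (by fun_prop) _ _)
      fun t _ => truncWeight_le_truncPot hα hM (by positivity)
  rw [intervalIntegral.integral_add (Continuous.intervalIntegrable (by fun_prop) _ _)
      (Continuous.intervalIntegrable (by fun_prop) _ _),
    intervalIntegral.integral_add (Continuous.intervalIntegrable (by fun_prop) _ _)
      (Continuous.intervalIntegrable (by fun_prop) _ _),
    intervalIntegral.integral_const_mul, intervalIntegral.integral_const_mul] at hstep
  change _ ≤ potInt α M f + _ + _ at hstep
  have hexp : 1 + potRate α * b ^ 2 ≤ Real.exp (potRate α * b ^ 2) := by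
    linarith [Real.add_one_le_exp (potRate α * b ^ 2)]
  refine le_trans ?_ (mul_le_mul_of_nonneg_left hexp (by linarith))
  have h5 : 2 * b * ∫ t in (0 : ℝ)..1, (g t * (starRingEnd ℂ) (expo x t)).re ≤ 2 * b * b := by
    gcongr
  have h6 : (1 + 5 * powLip α) * b ^ 2 * ∫ t in (0 : ℝ)..1, truncWeight α M (‖f t‖ ^ 2) ≤
      (1 + 5 * powLip α) * b ^ 2 * (2 ^ (α + 1) * (1 + potInt α M f)) := by
    gcongr
  unfold potRate
  nlinarith [mul_nonneg (sq_nonneg b) hG]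

end Potential

section LargeValues

/-- A quadratic-form comparison: if the exponential sums over `S` and `δ`-weighted over `T` are
uniformly close, so are the quadratic forms of Fourier coefficients. -/
lemma sum_trigCoeff_le_of_close {S T : Finset ℤ} {δ B : ℝ} (hδ : 0 ≤ δ)
    (hST : ∀ θ : ℝ, ‖∑ x ∈ S, expo x θ - δ * ∑ x ∈ T, expo x θ‖ ≤ B)
    {f : ℝ → ℂ} (hf : Continuous f) :
    ∑ x ∈ S, ‖trigCoeff f x‖ ^ 2 ≤
      δ * (∫ t in (0 : ℝ)..1, ‖f t‖ ^ 2) + B * (∫ t in (0 : ℝ)..1, ‖f t‖) ^ 2 := by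
  set c := trigCoeff f with hc
  have he := continuous_expo
  set D : ℝ → ℂ := fun s => ∑ x ∈ S, c x * expo x s - δ * ∑ x ∈ T, c x * expo x s with hD
  have hDc : Continuous D := by fun_prop
  have hDle : ∀ s, ‖D s‖ ≤ B * ∫ t in (0 : ℝ)..1, ‖f t‖ := by
    intro s
    have h1 : ∀ U : Finset ℤ, ∑ x ∈ U, c x * expo x s =
        ∫ t in (0 : ℝ)..1, f t * ∑ x ∈ U, expo x (s - t) := by
      intro U
      simp_rw [hc, trigCoeff, ← intervalIntegral.integral_mul_const, Finset.mul_sum]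
      rw [intervalIntegral.integral_finsetSum
        (fun x _ => Continuous.intervalIntegrable (by fun_prop) _ _)]
      refine Finset.sum_congr rfl fun x _ => intervalIntegral.integral_congr fun t _ => ?_
      simp only [sub_eq_neg_add, expo_add, conj_expo]
      ring
    have h2 : D s = ∫ t in (0 : ℝ)..1, f t *
        (∑ x ∈ S, expo x (s - t) - δ * ∑ x ∈ T, expo x (s - t)) := by
      simp only [hD]
      rw [h1, h1, ← intervalIntegral.integral_const_mul, ← intervalIntegral.integral_sub
        (Continuous.intervalIntegrable (by fun_prop) _ _)
        (Continuous.intervalIntegrable (by fun_prop) _ _)]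
      exact intervalIntegral.integral_congr fun t _ => by ring
    rw [h2, ← intervalIntegral.integral_const_mul]
    refine (intervalIntegral.norm_integral_le_integral_norm zero_le_one).trans ?_
    refine intervalIntegral.integral_mono_on zero_le_one
      (Continuous.intervalIntegrable (by fun_prop) _ _)
      (Continuous.intervalIntegrable (by fun_prop) _ _) fun t _ => ?_
    rw [norm_mul, mul_comm]
    gcongr
    exact hST _
  have hsum : ∀ U : Finset ℤ, ∫ t in (0 : ℝ)..1, f t * (starRingEnd ℂ) (∑ x ∈ U, c x * expo x t) =
      ((∑ x ∈ U, ‖c x‖ ^ 2 : ℝ) : ℂ) := by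
    intro U
    rw [integral_mul_conj_expo_sum hf]
    push_cast
    exact Finset.sum_congr rfl fun x _ => by rw [← hc, Complex.conj_mul']
  have h_int : ∫ t in (0 : ℝ)..1, f t * (starRingEnd ℂ) (D t) =
      ((∑ x ∈ S, ‖c x‖ ^ 2 - δ * ∑ x ∈ T, ‖c x‖ ^ 2 : ℝ) : ℂ) := by
    rw [Complex.ofReal_sub, Complex.ofReal_mul, ← hsum, ← hsum,
      ← intervalIntegral.integral_const_mul, ← intervalIntegral.integral_sub
        (Continuous.intervalIntegrable (by fun_prop) _ _)
        (Continuous.intervalIntegrable (by fun_prop) _ _)]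
    refine intervalIntegral.integral_congr fun t _ => ?_
    simp only [hD, map_sub, map_mul, Complex.conj_ofReal]
    ring
  have hle : ∑ x ∈ S, ‖c x‖ ^ 2 - δ * ∑ x ∈ T, ‖c x‖ ^ 2 ≤
      B * (∫ t in (0 : ℝ)..1, ‖f t‖) ^ 2 := by
    have h3 : ‖∫ t in (0 : ℝ)..1, f t * (starRingEnd ℂ) (D t)‖ ≤
        B * (∫ t in (0 : ℝ)..1, ‖f t‖) ^ 2 := by
      refine (intervalIntegral.norm_integral_le_integral_norm zero_le_one).trans ?_
      rw [show B * (∫ t in (0 : ℝ)..1, ‖f t‖) ^ 2 =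
        (∫ t in (0 : ℝ)..1, ‖f t‖) * (B * ∫ t in (0 : ℝ)..1, ‖f t‖) by ring,
        ← intervalIntegral.integral_mul_const]
      refine intervalIntegral.integral_mono_on zero_le_one
        (Continuous.intervalIntegrable (by fun_prop) _ _)
        (Continuous.intervalIntegrable (by fun_prop) _ _) fun t _ => ?_
      rw [norm_mul, RCLike.norm_conj]
      gcongr
      exact hDle t
    rw [h_int, Complex.norm_real] at h3
    exact (le_abs_self _).trans h3
  have := mul_le_mul_of_nonneg_left (bessel_trigCoeff hf T) hδ
  linarith

/-- The `L^p` norm of a trigonometric polynomial is controlled by the truncated potential, as soon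
as its spectrum is uniformly distributed in a weak quantitative sense. -/
lemma integral_norm_rpow_le {S T : Finset ℤ} {α δ B K : ℝ} (hα : 0 < α) (hδ : 0 ≤ δ) (hB : 1 ≤ B)
    (hK : δ * (S.card : ℝ) ^ α ≤ K)
    (hST : ∀ θ : ℝ, ‖∑ x ∈ S, expo x θ - δ * ∑ x ∈ T, expo x θ‖ ≤ B)
    {a : ℤ → ℂ} (ha : ∑ x ∈ S, ‖a x‖ ^ 2 ≤ 1) :
    ∫ t in (0 : ℝ)..1, ‖∑ x ∈ S, a x * expo x t‖ ^ (2 + 2 * α) ≤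
      2 * K + 2 ^ (α + 1) * potInt α (2 * B) (fun t => ∑ x ∈ S, a x * expo x t) := by
  have he := continuous_expo
  set f : ℝ → ℂ := fun t => ∑ x ∈ S, a x * expo x t with hf
  have hfc : Continuous f := by fun_prop
  have hM : (1 : ℝ) ≤ 2 * B := by linarith
  have hsup : ∀ t, ‖f t‖ ^ 2 ≤ S.card := by
    intro t
    have h1 : ‖f t‖ ≤ ∑ x ∈ S, ‖a x‖ * 1 := by
      refine (norm_sum_le _ _).trans (le_of_eq ?_)
      exact Finset.sum_congr rfl fun x _ => by rw [norm_mul, norm_expo]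
    calc ‖f t‖ ^ 2 ≤ (∑ x ∈ S, ‖a x‖ * 1) ^ 2 := by gcongr
      _ ≤ (∑ x ∈ S, ‖a x‖ ^ 2) * ∑ x ∈ S, 1 ^ 2 := Finset.sum_mul_sq_le_sq_mul_sq _ _ _
      _ ≤ 1 * S.card := by
        gcongr
        simp
      _ = _ := one_mul _
  set w : ℝ → ℝ := fun t => (‖f t‖ ^ 2) ^ α - (min (‖f t‖ ^ 2) (2 * B)) ^ α with hw
  have hr : Continuous fun u : ℝ => u ^ α := Real.continuous_rpow_const hα.le
  have hr1 : Continuous fun t : ℝ => (‖f t‖ ^ 2) ^ α := hr.comp (by fun_prop)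
  have hr2 : Continuous fun t : ℝ => (min (‖f t‖ ^ 2) (2 * B)) ^ α :=
    hr.comp (by fun_prop)
  have hwc : Continuous w := hr1.sub hr2
  have hw0 : ∀ t, 0 ≤ w t := fun t => sub_nonneg.2
    (Real.rpow_le_rpow (le_min (by positivity) (by linarith)) (min_le_left _ _) hα.le)
  have hwle : ∀ t, w t ≤ (S.card : ℝ) ^ α := fun t => by
    have h1 : (‖f t‖ ^ 2) ^ α ≤ (S.card : ℝ) ^ α :=
      Real.rpow_le_rpow (by positivity) (hsup t) hα.le
    have h2 : 0 ≤ (min (‖f t‖ ^ 2) (2 * B)) ^ α :=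
      Real.rpow_nonneg (le_min (by positivity) (by linarith)) α
    simp only [hw]; linarith
  have hwM : ∀ t, Real.sqrt (2 * B) * (w t * ‖f t‖) ≤ w t * ‖f t‖ ^ 2 := by
    intro t
    rcases le_total (‖f t‖ ^ 2) (2 * B) with h | h
    · have : w t = 0 := by simp only [hw]; rw [min_eq_left h, sub_self]
      simp [this]
    · have h1 : Real.sqrt (2 * B) ≤ ‖f t‖ := by
        rw [← Real.sqrt_sq (norm_nonneg (f t))]
        exact Real.sqrt_le_sqrt h
      have := mul_le_mul_of_nonneg_right h1 (mul_nonneg (hw0 t) (norm_nonneg (f t)))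
      linarith
  set I := ∫ t in (0 : ℝ)..1, w t * ‖f t‖ ^ 2 with hI
  have hI0 : 0 ≤ I := intervalIntegral.integral_nonneg zero_le_one
    fun t _ => mul_nonneg (hw0 t) (by positivity)
  set F : ℝ → ℂ := fun t => (w t : ℂ) * f t with hF
  have hFc : Continuous F := by fun_prop
  have hFn : ∀ t, ‖F t‖ = w t * ‖f t‖ := fun t => by
    rw [hF, norm_mul, Complex.norm_real, Real.norm_of_nonneg (hw0 t)]
  have hpair : (I : ℂ) = ∑ x ∈ S, (starRingEnd ℂ) (a x) * trigCoeff F x := by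
    rw [← integral_mul_conj_expo_sum hFc, hI, ← intervalIntegral.integral_ofReal]
    refine intervalIntegral.integral_congr fun t _ => ?_
    change _ = (w t : ℂ) * f t * (starRingEnd ℂ) (f t)
    rw [mul_assoc, Complex.mul_conj']
    push_cast; rfl
  have hI1 : I ^ 2 ≤ ∑ x ∈ S, ‖trigCoeff F x‖ ^ 2 := by
    have h1 : I ≤ ∑ x ∈ S, ‖a x‖ * ‖trigCoeff F x‖ := by
      have h2 : ‖(I : ℂ)‖ ≤ ∑ x ∈ S, ‖a x‖ * ‖trigCoeff F x‖ := by
        rw [hpair]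
        refine (norm_sum_le _ _).trans (le_of_eq ?_)
        exact Finset.sum_congr rfl fun x _ => by rw [norm_mul, RCLike.norm_conj]
      rw [Complex.norm_real] at h2
      exact (le_abs_self _).trans h2
    calc I ^ 2 ≤ (∑ x ∈ S, ‖a x‖ * ‖trigCoeff F x‖) ^ 2 := by gcongr
      _ ≤ (∑ x ∈ S, ‖a x‖ ^ 2) * ∑ x ∈ S, ‖trigCoeff F x‖ ^ 2 :=
        Finset.sum_mul_sq_le_sq_mul_sq _ _ _
      _ ≤ 1 * ∑ x ∈ S, ‖trigCoeff F x‖ ^ 2 := by gcongr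
      _ = _ := one_mul _
  have hF2 : ∫ t in (0 : ℝ)..1, ‖F t‖ ^ 2 ≤ (S.card : ℝ) ^ α * I := by
    rw [hI, ← intervalIntegral.integral_const_mul]
    refine intervalIntegral.integral_mono_on zero_le_one
      (Continuous.intervalIntegrable (by fun_prop) _ _)
      (Continuous.intervalIntegrable (by fun_prop) _ _) fun t _ => ?_
    rw [hFn]
    calc (w t * ‖f t‖) ^ 2 = w t * (w t * ‖f t‖ ^ 2) := by ring
      _ ≤ _ := mul_le_mul_of_nonneg_right (hwle t) (mul_nonneg (hw0 t) (by positivity))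
  have hF1 : 2 * B * (∫ t in (0 : ℝ)..1, ‖F t‖) ^ 2 ≤ I ^ 2 := by
    have h1 : Real.sqrt (2 * B) * ∫ t in (0 : ℝ)..1, ‖F t‖ ≤ I := by
      rw [hI, ← intervalIntegral.integral_const_mul]
      refine intervalIntegral.integral_mono_on zero_le_one
        (Continuous.intervalIntegrable (by fun_prop) _ _)
        (Continuous.intervalIntegrable (by fun_prop) _ _) fun t _ => ?_
      rw [hFn]; exact hwM t
    have h2 : 0 ≤ ∫ t in (0 : ℝ)..1, ‖F t‖ :=
      intervalIntegral.integral_nonneg zero_le_one fun _ _ => norm_nonneg _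
    calc 2 * B * (∫ t in (0 : ℝ)..1, ‖F t‖) ^ 2
        = (Real.sqrt (2 * B) * ∫ t in (0 : ℝ)..1, ‖F t‖) ^ 2 := by
          rw [mul_pow, Real.sq_sqrt (by linarith)]
      _ ≤ _ := by gcongr
  have hmain := sum_trigCoeff_le_of_close hδ hST hFc
  have hIK : I ≤ 2 * K := by
    have h1 : δ * ∫ t in (0 : ℝ)..1, ‖F t‖ ^ 2 ≤ K * I := by
      calc _ ≤ δ * ((S.card : ℝ) ^ α * I) := by gcongr
        _ = (δ * (S.card : ℝ) ^ α) * I := by ring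
        _ ≤ _ := by gcongr
    rcases hI0.eq_or_lt with h | h
    · rw [← h]
      have : 0 ≤ δ * (S.card : ℝ) ^ α := mul_nonneg hδ (Real.rpow_nonneg (Nat.cast_nonneg _) _)
      linarith
    · have : I * I ≤ 2 * K * I := by nlinarith
      exact le_of_mul_le_mul_right this h
  have hfin : ∫ t in (0 : ℝ)..1, ‖f t‖ ^ (2 + 2 * α) ≤
      ∫ t in (0 : ℝ)..1, (w t * ‖f t‖ ^ 2 + ‖f t‖ ^ 2 * truncWeight α (2 * B) (‖f t‖ ^ 2)) := by
    have htw := continuous_truncWeight (M := 2 * B) hα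
    have hp : Continuous fun u : ℝ => u ^ (2 + 2 * α) := Real.continuous_rpow_const (by linarith)
    have hp1 : Continuous fun t => ‖f t‖ ^ (2 + 2 * α) := hp.comp (by fun_prop)
    refine intervalIntegral.integral_mono_on zero_le_one (hp1.intervalIntegrable _ _)
      (Continuous.intervalIntegrable (by fun_prop) _ _) fun t _ => ?_
    have h1 : ‖f t‖ ^ (2 + 2 * α) = ‖f t‖ ^ 2 * (‖f t‖ ^ 2) ^ α := by
      rw [Real.rpow_add_of_nonneg (norm_nonneg _) (by norm_num) (by linarith), Real.rpow_mul
        (norm_nonneg _)]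
      simp
    have h2 : (min (‖f t‖ ^ 2) (2 * B)) ^ α ≤ truncWeight α (2 * B) (‖f t‖ ^ 2) :=
      Real.rpow_le_rpow (le_min (by positivity) (by linarith))
        (min_le_min (by linarith) le_rfl) hα.le
    have h3 := mul_le_mul_of_nonneg_left h2 (by positivity : 0 ≤ ‖f t‖ ^ 2)
    rw [h1]
    simp only [hw]
    linarith
  have htw := continuous_truncWeight (M := 2 * B) hα
  rw [intervalIntegral.integral_add (Continuous.intervalIntegrable (by fun_prop) _ _)
    (Continuous.intervalIntegrable (by fun_prop) _ _)] at hfin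
  linarith [integral_sq_mul_truncWeight_le hα hM hfc]

end LargeValues

section Discrepancy

variable {n L : ℕ}

/-- Exponential Markov inequality for a sum of independent centred variables, in counting form. -/
lemma card_sum_ge_le (Y : Fin n → Fin L → ℝ) (h0 : ∀ k, ∑ j, Y k j = 0) (h2 : ∀ k j, |Y k j| ≤ 2)
    {s T : ℝ} (hs : 0 ≤ s) (hs1 : 2 * s ≤ 1) :
    (((Finset.univ : Finset (Fin n → Fin L)).filter (fun ω => T ≤ ∑ k, Y k (ω k))).card : ℝ) ≤
      (L : ℝ) ^ n * Real.exp (4 * n * s ^ 2 - s * T) := by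
  set E := (Finset.univ : Finset (Fin n → Fin L)).filter (fun ω => T ≤ ∑ k, Y k (ω k)) with hE
  have h1 : (E.card : ℝ) * Real.exp (s * T) ≤ ∑ ω : Fin n → Fin L, ∏ k, Real.exp (s * Y k (ω k)) := by
    calc (E.card : ℝ) * Real.exp (s * T) = ∑ _ω ∈ E, Real.exp (s * T) := by
          rw [Finset.sum_const, nsmul_eq_mul]
      _ ≤ ∑ ω ∈ E, ∏ k, Real.exp (s * Y k (ω k)) := by
          refine Finset.sum_le_sum fun ω hω => ?_
          rw [← Real.exp_sum, ← Finset.mul_sum]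
          have := (Finset.mem_filter.1 hω).2
          gcongr
      _ ≤ _ := Finset.sum_le_sum_of_subset_of_nonneg (Finset.subset_univ _)
          fun _ _ _ => Finset.prod_nonneg fun _ _ => (Real.exp_pos _).le
  have h3 : ∑ ω : Fin n → Fin L, ∏ k, Real.exp (s * Y k (ω k)) =
      ∏ k, ∑ j, Real.exp (s * Y k j) := by
    rw [Finset.prod_univ_sum, Fintype.piFinset_univ]
  have h4 : ∀ k, ∑ j, Real.exp (s * Y k j) ≤ L * Real.exp (4 * s ^ 2) := by
    intro k
    have h5 : ∀ j, Real.exp (s * Y k j) ≤ 1 + s * Y k j + 4 * s ^ 2 := by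
      intro j
      have h6 : |s * Y k j| ≤ 2 * s := by
        rw [abs_mul, abs_of_nonneg hs]
        nlinarith [h2 k j]
      have h7 := (abs_le.1 (Real.abs_exp_sub_one_sub_id_le (h6.trans hs1))).2
      have h8 : (s * Y k j) ^ 2 ≤ (2 * s) ^ 2 := sq_le_sq' (by linarith [(abs_le.1 h6).1])
        (abs_le.1 h6).2
      linarith
    calc ∑ j, Real.exp (s * Y k j) ≤ ∑ j, (1 + s * Y k j + 4 * s ^ 2) :=
          Finset.sum_le_sum fun j _ => h5 j
      _ = L * (4 * s ^ 2 + 1) := by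
          rw [Finset.sum_add_distrib, Finset.sum_add_distrib, ← Finset.mul_sum, h0]
          simp; ring
      _ ≤ _ := by gcongr; exact Real.add_one_le_exp _
  have h9 : ∏ k, ∑ j, Real.exp (s * Y k j) ≤ (L * Real.exp (4 * s ^ 2)) ^ n := by
    calc _ ≤ ∏ _k : Fin n, (L * Real.exp (4 * s ^ 2) : ℝ) :=
          Finset.prod_le_prod (fun _ _ => Finset.sum_nonneg fun _ _ => (Real.exp_pos _).le)
            fun k _ => h4 k
      _ = _ := by simp
  rw [Real.exp_sub, ← mul_div_assoc, le_div_iff₀ (Real.exp_pos _)]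
  refine h1.trans (h3.le.trans (h9.trans (le_of_eq ?_)))
  rw [mul_pow, ← Real.exp_nat_mul]
  congr 2; ring

lemma norm_le_of_forall_re_lt {z : ℂ} {T : ℝ} (h : ∀ i ∈ Finset.range 4, (Complex.I ^ i * z).re < T) :
    ‖z‖ ≤ 2 * T := by
  have h0 := h 0 (by simp)
  have h1 := h 1 (by simp)
  have h2 := h 2 (by simp)
  have h3 := h 3 (by simp)
  simp [pow_succ] at h0 h1 h2 h3
  have a : |z.re| ≤ T := abs_le.2 ⟨by linarith, by linarith⟩
  have b : |z.im| ≤ T := abs_le.2 ⟨by linarith, by linarith⟩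
  linarith [Complex.norm_le_abs_re_add_abs_im z]

/-- The frequency attached to position `j` of the `k`-th cell of length `L`. -/
def cellFreq (k : Fin n) (j : Fin L) : ℤ := (k : ℤ) * L + j + 1

lemma cellFreq_pos (k : Fin n) (j : Fin L) : 1 ≤ cellFreq k j := by
  have : (0 : ℤ) ≤ (k : ℤ) * L + j := by positivity
  unfold cellFreq; linarith

lemma cellFreq_le (k : Fin n) (j : Fin L) : cellFreq k j ≤ n * L := by
  have h1 : ((j : ℕ) : ℤ) + 1 ≤ L := by exact_mod_cast j.2
  have h2 : ((k : ℕ) : ℤ) + 1 ≤ n := by exact_mod_cast k.2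
  have h3 : (0 : ℤ) ≤ L := by positivity
  unfold cellFreq
  nlinarith

lemma cellFreq_injective : Function.Injective fun x : Fin n × Fin L => cellFreq x.1 x.2 := by
  rintro ⟨k, j⟩ ⟨k', j'⟩ h
  simp only [cellFreq] at h
  have h1 : (k : ℕ) * L + j = (k' : ℕ) * L + j' := by
    have h2 : ((k : ℕ) : ℤ) * L + j = ((k' : ℕ) : ℤ) * L + j' := by linarith
    exact_mod_cast h2
  have hL : 0 < L := j.pos
  have hk : (k : ℕ) = k' := by
    have := congrArg (· / L) h1
    simpa [Nat.add_div_of_dvd_right, Nat.add_comm, Nat.add_mul_div_right _ _ hL,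
      Nat.div_eq_of_lt j.2, Nat.div_eq_of_lt j'.2] using this
  have hj : (j : ℕ) = j' := by rw [hk] at h1; omega
  exact Prod.ext (Fin.ext hk) (Fin.ext hj)

/-- The discrepancy between the sampled exponential sum and its mean. -/
def cellDisc (ω : Fin n → Fin L) (θ : ℝ) : ℂ :=
  ∑ k, (expo (cellFreq k (ω k)) θ - (1 / L : ℝ) * ∑ j : Fin L, expo (cellFreq k j) θ)

lemma expo_periodic (x : ℤ) (θ : ℝ) (m : ℤ) : expo x (θ + m) = expo x θ := by
  rw [expo_add]
  have : expo x (m : ℝ) = 1 := by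
    unfold expo
    rw [Complex.exp_eq_one_iff]
    exact ⟨x * m, by push_cast; ring⟩
  rw [this, mul_one]

lemma cellDisc_fract (ω : Fin n → Fin L) (θ : ℝ) : cellDisc ω (Int.fract θ) = cellDisc ω θ := by
  have : ∀ x : ℤ, expo x (Int.fract θ) = expo x θ := fun x => by
    conv_rhs => rw [← Int.fract_add_floor θ, expo_periodic]
  simp only [cellDisc, this]

lemma norm_expo_sub_le (x : ℤ) (θ θ' : ℝ) :
    ‖expo x θ - expo x θ'‖ ≤ 2 * π * |(x : ℝ)| * |θ - θ'| := by
  have h1 : expo x θ = expo x (θ - θ') * expo x θ' := by rw [← expo_add, sub_add_cancel]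
  rw [h1, show expo x (θ - θ') * expo x θ' - expo x θ' = (expo x (θ - θ') - 1) * expo x θ' by ring,
    norm_mul, norm_expo, mul_one, expo_eq, mul_comm _ Complex.I]
  refine (Real.norm_exp_I_mul_ofReal_sub_one_le).trans (le_of_eq ?_)
  rw [Real.norm_eq_abs, abs_mul, abs_mul, abs_of_pos Real.two_pi_pos]

lemma norm_cellDisc_sub_le (ω : Fin n → Fin L) (hL : 0 < L) (θ θ' : ℝ) :
    ‖cellDisc ω θ - cellDisc ω θ'‖ ≤ 4 * π * (n ^ 2 * L) * |θ - θ'| := by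
  have hL' : (0 : ℝ) < L := by exact_mod_cast hL
  set K : ℝ := 2 * π * (n * L) * |θ - θ'| with hK
  have h1 : ∀ (k : Fin n) (j : Fin L), ‖expo (cellFreq k j) θ - expo (cellFreq k j) θ'‖ ≤ K := by
    intro k j
    refine (norm_expo_sub_le _ _ _).trans ?_
    have h2 : |(cellFreq k j : ℝ)| ≤ n * L := by
      rw [abs_of_nonneg (by exact_mod_cast (zero_le_one.trans (cellFreq_pos k j)))]
      exact_mod_cast cellFreq_le k j
    rw [hK]; gcongr
  have h3 : ∀ k : Fin n, ‖(expo (cellFreq k (ω k)) θ - (1 / L : ℝ) * ∑ j : Fin L,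
      expo (cellFreq k j) θ) - (expo (cellFreq k (ω k)) θ' - (1 / L : ℝ) * ∑ j : Fin L,
      expo (cellFreq k j) θ')‖ ≤ 2 * K := by
    intro k
    rw [sub_sub_sub_comm, ← mul_sub, ← Finset.sum_sub_distrib]
    refine (norm_sub_le _ _).trans ?_
    have h4 : ‖∑ j : Fin L, (expo (cellFreq k j) θ - expo (cellFreq k j) θ')‖ ≤ L * K := by
      refine (norm_sum_le _ _).trans ((Finset.sum_le_sum fun j _ => h1 k j).trans ?_)
      simp
    have h5 : ‖((1 / L : ℝ) : ℂ) * ∑ j : Fin L,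
        (expo (cellFreq k j) θ - expo (cellFreq k j) θ')‖ ≤ K := by
      rw [norm_mul, Complex.norm_real, Real.norm_of_nonneg (by positivity)]
      calc _ ≤ 1 / L * (L * K) := by gcongr
        _ = K := by field_simp
    linarith [h1 k (ω k)]
  unfold cellDisc
  rw [← Finset.sum_sub_distrib]
  refine (norm_sum_le _ _).trans ((Finset.sum_le_sum fun k _ => h3 k).trans (le_of_eq ?_))
  simp [hK]; ring

open Classical in
/-- With few exceptions, the discrepancy of a random selection is uniformly small. -/
lemma card_cellDisc_gt_le (hn : 0 < n) (hL : 0 < L) {s T : ℝ} (hs : 0 ≤ s) (hs1 : 2 * s ≤ 1) :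
    (((Finset.univ : Finset (Fin n → Fin L)).filter
      (fun ω => ¬ ∀ θ, ‖cellDisc ω θ‖ ≤ 2 * T + 1 / 2)).card : ℝ) ≤
      (4 * (32 * n ^ 2 * L)) * ((L : ℝ) ^ n * Real.exp (4 * n * s ^ 2 - s * T)) := by
  have hL' : (0 : ℝ) < L := by exact_mod_cast hL
  set G : ℕ := 32 * n ^ 2 * L with hG
  have hG0 : 0 < G := by positivity
  have hG0' : (0 : ℝ) < G := by exact_mod_cast hG0
  set bad : ℕ × ℕ → Finset (Fin n → Fin L) := fun q =>
    Finset.univ.filter (fun ω => T ≤ (Complex.I ^ q.1 * cellDisc ω (q.2 / G)).re) with hbad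
  have hsub : Finset.univ.filter (fun ω : Fin n → Fin L => ¬ ∀ θ, ‖cellDisc ω θ‖ ≤ 2 * T + 1 / 2) ⊆
      (Finset.range 4 ×ˢ Finset.range G).biUnion bad := by
    intro ω hω
    by_contra hcon
    refine (Finset.mem_filter.1 hω).2 fun θ => ?_
    have hgrid : ∀ i ∈ Finset.range G, ‖cellDisc ω ((i : ℕ) / G)‖ ≤ 2 * T := by
      intro i hi
      refine norm_le_of_forall_re_lt fun m hm => ?_
      by_contra hle
      exact hcon (Finset.mem_biUnion.2 ⟨(m, i), Finset.mem_product.2 ⟨hm, hi⟩,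
        Finset.mem_filter.2 ⟨Finset.mem_univ _, not_lt.1 hle⟩⟩)
    rw [← cellDisc_fract]
    set t := Int.fract θ with ht
    have ht0 : 0 ≤ t := Int.fract_nonneg θ
    have ht1 : t < 1 := Int.fract_lt_one θ
    set i := ⌊t * G⌋₊ with hi
    have hi1 : (i : ℝ) ≤ t * G := Nat.floor_le (by positivity)
    have hi2 : t * G < i + 1 := Nat.lt_floor_add_one _
    have hiG : i < G := (Nat.floor_lt (by positivity)).2 (by nlinarith)
    have hdist : |t - i / G| ≤ 1 / G := by
      rw [show t - i / G = (t * G - i) / G by field_simp, abs_div, abs_of_pos hG0']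
      gcongr
      rw [abs_of_nonneg (by linarith)]; linarith
    have h1 := norm_cellDisc_sub_le ω hL t (i / G)
    have h2 : 4 * π * (n ^ 2 * L) * |t - i / G| ≤ 1 / 2 := by
      calc _ ≤ 4 * π * (n ^ 2 * L) * (1 / G) := by gcongr
        _ = π / 8 := by rw [hG]; push_cast; field_simp; norm_num
        _ ≤ _ := by linarith [Real.pi_le_four]
    have h3 := hgrid i (Finset.mem_range.2 hiG)
    have h4 := norm_sub_norm_le (cellDisc ω t) (cellDisc ω (i / G))
    linarith
  have hcard : ∀ q ∈ Finset.range 4 ×ˢ Finset.range G,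
      ((bad q).card : ℝ) ≤ (L : ℝ) ^ n * Real.exp (4 * n * s ^ 2 - s * T) := by
    intro q _
    set g : Fin n → Fin L → ℂ := fun k j => expo (cellFreq k j) (q.2 / G) with hg
    have := card_sum_ge_le (T := T)
      (fun k j => (Complex.I ^ q.1 * (g k j - (1 / L : ℝ) * ∑ j, g k j)).re)
      (fun k => by
        rw [← Complex.re_sum, ← Finset.mul_sum, Finset.sum_sub_distrib, Finset.sum_const,
          Finset.card_univ, Fintype.card_fin, nsmul_eq_mul, ← mul_assoc]
        push_cast
        rw [mul_one_div_cancel (by exact_mod_cast hL'.ne'), one_mul, sub_self, mul_zero,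
          Complex.zero_re])
      (fun k j => by
        refine (Complex.abs_re_le_norm _).trans ?_
        rw [norm_mul, norm_pow, Complex.norm_I, one_pow, one_mul]
        refine (norm_sub_le _ _).trans ?_
        have h1 : ‖∑ j, g k j‖ ≤ L := by
          refine (norm_sum_le _ _).trans (le_of_eq ?_)
          simp [hg, norm_expo]
        have h2 : ‖((1 / L : ℝ) : ℂ) * ∑ j, g k j‖ ≤ 1 := by
          rw [norm_mul, Complex.norm_real, Real.norm_of_nonneg (by positivity)]
          calc _ ≤ 1 / (L : ℝ) * L := by gcongr
            _ = 1 := by field_simp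
        have h3 : ‖g k j‖ = 1 := norm_expo _ _
        linarith) hs hs1
    refine le_trans (le_of_eq ?_) this
    simp only [hbad, cellDisc, Finset.mul_sum, Complex.re_sum, hg]
  calc _ ≤ ((((Finset.range 4 ×ˢ Finset.range G).biUnion bad).card : ℕ) : ℝ) := by
        exact_mod_cast Finset.card_le_card hsub
    _ ≤ ((∑ q ∈ Finset.range 4 ×ˢ Finset.range G, (bad q).card : ℕ) : ℝ) := by
        exact_mod_cast Finset.card_biUnion_le
    _ ≤ ∑ _q ∈ Finset.range 4 ×ˢ Finset.range G,
          ((L : ℝ) ^ n * Real.exp (4 * n * s ^ 2 - s * T)) := by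
        push_cast; exact Finset.sum_le_sum hcard
    _ = _ := by
        rw [Finset.sum_const, nsmul_eq_mul, Finset.card_product, Finset.card_range,
          Finset.card_range, hG]
        push_cast; ring

end Discrepancy

section Peeling

variable {n L : ℕ}

open Classical in
/-- Chernoff bound for the number of selected points in a fixed set, in counting form. -/
lemma card_hits_ge_le (hL : 0 < L) (M : Finset (Fin n × Fin L)) {s : ℝ} (hs : 0 ≤ s) (ρ : ℝ) :
    (((Finset.univ : Finset (Fin n → Fin L)).filter
      (fun ω => ρ ≤ ((Finset.univ.filter fun k => (k, ω k) ∈ M).card : ℝ))).card : ℝ) ≤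
      (L : ℝ) ^ n * Real.exp (Real.exp s * (M.card / L) - s * ρ) := by
  have hL' : (0 : ℝ) < L := by exact_mod_cast hL
  set Y : Fin n → Fin L → ℝ := fun k j => if (k, j) ∈ M then 1 else 0 with hY
  set E := (Finset.univ : Finset (Fin n → Fin L)).filter
    (fun ω => ρ ≤ ((Finset.univ.filter fun k => (k, ω k) ∈ M).card : ℝ)) with hE
  have h1 : (E.card : ℝ) * Real.exp (s * ρ) ≤ ∑ ω : Fin n → Fin L, ∏ k, Real.exp (s * Y k (ω k)) := by
    calc (E.card : ℝ) * Real.exp (s * ρ) = ∑ _ω ∈ E, Real.exp (s * ρ) := by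
          rw [Finset.sum_const, nsmul_eq_mul]
      _ ≤ ∑ ω ∈ E, ∏ k, Real.exp (s * Y k (ω k)) := by
          refine Finset.sum_le_sum fun ω hω => ?_
          rw [← Real.exp_sum, ← Finset.mul_sum]
          have h2 := (Finset.mem_filter.1 hω).2
          have h3 : ∑ k, Y k (ω k) = ((Finset.univ.filter fun k => (k, ω k) ∈ M).card : ℝ) := by
            simp only [hY]
            rw [Finset.sum_boole]
          rw [h3]
          gcongr
      _ ≤ _ := Finset.sum_le_sum_of_subset_of_nonneg (Finset.subset_univ _)
          fun _ _ _ => Finset.prod_nonneg fun _ _ => (Real.exp_pos _).le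
  have h3 : ∑ ω : Fin n → Fin L, ∏ k, Real.exp (s * Y k (ω k)) =
      ∏ k, ∑ j, Real.exp (s * Y k j) := by
    rw [Finset.prod_univ_sum, Fintype.piFinset_univ]
  have hsum : ∑ k, ∑ j, Y k j = M.card := by
    rw [← Fintype.sum_prod_type']
    simp [hY]
  have h4 : ∀ k, ∑ j, Real.exp (s * Y k j) ≤
      L * Real.exp (Real.exp s * ((∑ j, Y k j) / L)) := by
    intro k
    have h5 : ∀ j, Real.exp (s * Y k j) ≤ 1 + Real.exp s * Y k j := by
      intro j
      simp only [hY]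
      split_ifs <;> simp
    calc ∑ j, Real.exp (s * Y k j) ≤ ∑ j, (1 + Real.exp s * Y k j) :=
          Finset.sum_le_sum fun j _ => h5 j
      _ = L * (Real.exp s * ((∑ j, Y k j) / L) + 1) := by
          rw [Finset.sum_add_distrib, ← Finset.mul_sum]
          simp; field_simp; ring
      _ ≤ _ := by gcongr; exact Real.add_one_le_exp _
  have h9 : ∏ k, ∑ j, Real.exp (s * Y k j) ≤
      (L : ℝ) ^ n * Real.exp (Real.exp s * (M.card / L)) := by
    calc _ ≤ ∏ k : Fin n, (L * Real.exp (Real.exp s * ((∑ j, Y k j) / L)) : ℝ) :=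
          Finset.prod_le_prod (fun _ _ => Finset.sum_nonneg fun _ _ => (Real.exp_pos _).le)
            fun k _ => h4 k
      _ = _ := by
          rw [Finset.prod_mul_distrib, ← Real.exp_sum, ← Finset.mul_sum, ← Finset.sum_div, hsum]
          simp
  rw [Real.exp_sub, ← mul_div_assoc, le_div_iff₀ (Real.exp_pos _)]
  exact h1.trans (h3.le.trans h9)

/-- The dyadically weighted exponential sum indexed by a set of cells, positions and levels. -/
def levelSum {J : ℕ} (U : Finset (Fin n × Fin L × Fin (J + 1))) (t : ℝ) : ℂ :=
  ∑ x ∈ U, (((2 : ℝ)⁻¹ ^ (x.2.2 : ℕ) : ℝ) : ℂ) * expo (cellFreq x.1 x.2.1) t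

lemma continuous_levelSum {J : ℕ} (U : Finset (Fin n × Fin L × Fin (J + 1))) :
    Continuous (levelSum U) := by
  have := continuous_expo
  unfold levelSum; fun_prop

/-- A selection `ω` is peelable when, for every dyadic sum of small potential, few selected
frequencies carry a large Fourier coefficient of the gradient field. -/
def Peelable (α M β C : ℝ) (J : ℕ) (ω : Fin n → Fin L) : Prop :=
  ∀ U : Finset (Fin n × Fin L × Fin (J + 1)),
    1 + potInt α M (levelSum U) ≤ Real.exp (potRate α) → ∀ l : Fin (J + 1),
      ((Finset.univ.filter fun k => (2 : ℝ)⁻¹ ^ (l : ℕ) <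
        ‖trigCoeff (potGrad α M (levelSum U)) (cellFreq k (ω k))‖).card : ℝ) ≤
          C * U.card + 4 ^ (l : ℕ) * (n : ℝ) ^ (-β)

open Classical in
lemma sum_powerset_pow_le {ι : Type*} [Fintype ι] {x : ℝ} (hx : 0 ≤ x)
    (hx1 : Fintype.card ι * x ≤ 1) :
    ∑ U ∈ (Finset.univ : Finset (Finset ι)).erase ∅, x ^ U.card ≤ 2 * (Fintype.card ι * x) := by
  have h1 : ∑ U : Finset ι, x ^ U.card = (x + 1) ^ Fintype.card ι := by
    rw [← Fintype.sum_pow_mul_eq_add_pow ι x 1]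
    simp
  have h2 : (x + 1) ^ Fintype.card ι ≤ Real.exp (Fintype.card ι * x) := by
    rw [Real.exp_nat_mul]
    gcongr
    exact Real.add_one_le_exp x
  have h0 : 0 ≤ Fintype.card ι * x := by positivity
  have h3 := (abs_le.1 (Real.abs_exp_sub_one_le (x := Fintype.card ι * x)
    (by rwa [abs_of_nonneg h0]))).2
  rw [abs_of_nonneg h0] at h3
  have h4 := Finset.add_sum_erase Finset.univ (fun U : Finset ι => x ^ U.card)
    (Finset.mem_univ ∅)
  simp only [Finset.card_empty, pow_zero] at h4
  linarith

open Classical in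
/-- With few exceptions, a random selection is peelable. -/
lemma card_not_peelable_le {α β C : ℝ} {J : ℕ} (hα : 0 < α) (hβ : β = α / 8) (hC : 0 ≤ C)
    (hn : 0 < n) (hL : 0 < L) (hnL : (n : ℝ) ^ α ≤ 2 * L)
    (hD : 4 ^ (α + 1) * Real.exp (potRate α) ≤ β / 2 * Real.log n)
    (hx : (n * (L * (J + 1))) * (n : ℝ) ^ (-(β / 2 * C)) ≤ 1) :
    (((Finset.univ : Finset (Fin n → Fin L)).filter
      (fun ω => ¬ Peelable α (2 * (n : ℝ) ^ (3 / 4 : ℝ)) β C J ω)).card : ℝ) ≤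
      (L : ℝ) ^ n * ((J + 1) * (2 * ((n * (L * (J + 1))) * (n : ℝ) ^ (-(β / 2 * C))))) := by
  have hn' : (0 : ℝ) < n := by exact_mod_cast hn
  have hn1 : (1 : ℝ) ≤ n := by exact_mod_cast hn
  have hL' : (0 : ℝ) < L := by exact_mod_cast hL
  have hβ0 : 0 < β := by rw [hβ]; positivity
  set M : ℝ := 2 * (n : ℝ) ^ (3 / 4 : ℝ) with hM
  have hM1 : 1 ≤ M := by
    have := Real.one_le_rpow hn1 (by norm_num : (0 : ℝ) ≤ 3 / 4)
    linarith
  set x : ℝ := (n : ℝ) ^ (-(β / 2 * C)) with hxdef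
  have hlog : 0 ≤ Real.log n := Real.log_nonneg hn1
  set ρ : Finset (Fin n × Fin L × Fin (J + 1)) → Fin (J + 1) → ℝ := fun U l =>
    C * U.card + 4 ^ (l : ℕ) * (n : ℝ) ^ (-β) with hρ
  set cand : Finset (Fin n × Fin L × Fin (J + 1)) → Fin (J + 1) → Finset (Fin n × Fin L) :=
    fun U l => Finset.univ.filter fun y => (2 : ℝ)⁻¹ ^ (l : ℕ) <
        ‖trigCoeff (potGrad α M (levelSum U)) (cellFreq y.1 y.2)‖ with hcand
  set bad : Finset (Fin n × Fin L × Fin (J + 1)) × Fin (J + 1) → Finset (Fin n → Fin L) :=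
    fun q => if 1 + potInt α M (levelSum q.1) ≤ Real.exp (potRate α) then
      Finset.univ.filter (fun ω => ρ q.1 q.2 ≤
        ((Finset.univ.filter fun k => (k, ω k) ∈ cand q.1 q.2).card : ℝ)) else ∅ with hbad
  set P := (Finset.univ : Finset (Finset (Fin n × Fin L × Fin (J + 1)))).erase ∅ with hP
  have hsub : Finset.univ.filter (fun ω : Fin n → Fin L => ¬ Peelable α M β C J ω) ⊆
      (P ×ˢ (Finset.univ : Finset (Fin (J + 1)))).biUnion bad := by
    intro ω hω
    by_contra hcon
    refine (Finset.mem_filter.1 hω).2 fun U hU l => ?_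
    by_cases hUe : U = ∅
    · subst hUe
      have h1 : potGrad α M (levelSum (∅ : Finset (Fin n × Fin L × Fin (J + 1)))) = fun _ => 0 := by
        funext t; simp [potGrad, levelSum]
      rw [h1, Finset.filter_false_of_mem]
      · simp only [Finset.card_empty, Nat.cast_zero, mul_zero, zero_add]; positivity
      · intro k _
        simp [trigCoeff]
    · by_contra hle
      refine hcon (Finset.mem_biUnion.2 ⟨(U, l), Finset.mem_product.2
        ⟨Finset.mem_erase.2 ⟨hUe, Finset.mem_univ _⟩, Finset.mem_univ _⟩, ?_⟩)
      simp only [hbad, if_pos hU]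
      refine Finset.mem_filter.2 ⟨Finset.mem_univ _, ?_⟩
      simp only [hρ, hcand, Finset.mem_filter, Finset.mem_univ, true_and]
      exact (not_le.1 hle).le
  have hcard : ∀ q ∈ P ×ˢ (Finset.univ : Finset (Fin (J + 1))),
      ((bad q).card : ℝ) ≤ (L : ℝ) ^ n * x ^ q.1.card := by
    rintro ⟨U, l⟩ _
    simp only [hbad]
    split_ifs with hU
    swap
    · simp only [Finset.card_empty, Nat.cast_zero]; positivity
    refine (card_hits_ge_le hL (cand U l) (s := β * Real.log n) (by positivity) _).trans ?_
    gcongr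
    have hm : ((cand U l).card : ℝ) ≤
        4 ^ (l : ℕ) * (M ^ α * (2 ^ (α + 1) * Real.exp (potRate α))) := by
      have h1 := sum_trigCoeff_potGrad_le hα hM1 (continuous_levelSum U)
        ((cand U l).image fun y => cellFreq y.1 y.2)
      rw [Finset.sum_image (fun a _ b _ h => cellFreq_injective h)] at h1
      have h2 : ((cand U l).card : ℝ) * (4 : ℝ)⁻¹ ^ (l : ℕ) ≤
          ∑ y ∈ cand U l, ‖trigCoeff (potGrad α M (levelSum U)) (cellFreq y.1 y.2)‖ ^ 2 := by
        rw [← nsmul_eq_mul, ← Finset.sum_const]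
        refine Finset.sum_le_sum fun y hy => ?_
        have h3 := (Finset.mem_filter.1 hy).2
        calc (4 : ℝ)⁻¹ ^ (l : ℕ) = ((2 : ℝ)⁻¹ ^ (l : ℕ)) ^ 2 := by
              rw [← pow_mul, mul_comm, pow_mul]; norm_num
          _ ≤ _ := by gcongr
      have h4 : M ^ α * (2 ^ (α + 1) * potInt α M (levelSum U)) ≤
          M ^ α * (2 ^ (α + 1) * Real.exp (potRate α)) := by
        gcongr; linarith
      have h5 := h2.trans (h1.trans h4)
      rw [inv_pow, ← div_eq_mul_inv, div_le_iff₀ (by positivity)] at h5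
      linarith
    have hMα : M ^ α * 2 ^ (α + 1) = 4 ^ (α + 1) / 2 * (n : ℝ) ^ (6 * β) := by
      rw [hM, Real.mul_rpow (by norm_num) (by positivity), ← Real.rpow_mul hn'.le,
        show 3 / 4 * α = 6 * β by rw [hβ]; ring,
        show (4 : ℝ) = 2 * 2 by norm_num, Real.mul_rpow (by norm_num) (by norm_num),
        Real.rpow_add_one (by norm_num)]
      ring
    have hLinv : (n : ℝ) ^ (8 * β) / 2 ≤ L := by
      rw [show 8 * β = α by rw [hβ]; ring]; linarith
    have hlam : ((cand U l).card : ℝ) / L ≤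
        4 ^ (α + 1) * Real.exp (potRate α) * (4 ^ (l : ℕ) * (n : ℝ) ^ (-β) * (n : ℝ) ^ (-β)) := by
      rw [div_le_iff₀ hL']
      refine hm.trans ?_
      have h6 : (n : ℝ) ^ (6 * β) = (n : ℝ) ^ (-β) * (n : ℝ) ^ (-β) * (n : ℝ) ^ (8 * β) := by
        rw [← Real.rpow_add hn', ← Real.rpow_add hn']; congr 1; ring
      calc 4 ^ (l : ℕ) * (M ^ α * (2 ^ (α + 1) * Real.exp (potRate α)))
          = 4 ^ (l : ℕ) * (M ^ α * 2 ^ (α + 1)) * Real.exp (potRate α) := by ring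
        _ = 4 ^ (α + 1) * Real.exp (potRate α) * (4 ^ (l : ℕ) * (n : ℝ) ^ (-β) * (n : ℝ) ^ (-β))
            * ((n : ℝ) ^ (8 * β) / 2) := by rw [hMα, h6]; ring
        _ ≤ _ := by gcongr
    have hexps : Real.exp (β * Real.log n) = (n : ℝ) ^ β := by
      rw [Real.rpow_def_of_pos hn', mul_comm]
    have hnn : (n : ℝ) ^ β * (n : ℝ) ^ (-β) = 1 := by
      rw [← Real.rpow_add hn', add_neg_cancel, Real.rpow_zero]
    have hρ1 : (4 : ℝ) ^ (l : ℕ) * (n : ℝ) ^ (-β) ≤ ρ U l := by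
      simp only [hρ]
      have : 0 ≤ C * (U.card : ℝ) := by positivity
      linarith
    have hρ2 : C * (U.card : ℝ) ≤ ρ U l := by
      simp only [hρ]
      have : 0 ≤ (4 : ℝ) ^ (l : ℕ) * (n : ℝ) ^ (-β) := by positivity
      linarith
    have hρ0 : 0 ≤ ρ U l := le_trans (by positivity) hρ2
    have hmain : Real.exp (β * Real.log n) * ((cand U l).card / L) ≤
        β / 2 * Real.log n * ρ U l := by
      rw [hexps]
      calc (n : ℝ) ^ β * ((cand U l).card / L) ≤ (n : ℝ) ^ β * (4 ^ (α + 1) *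
            Real.exp (potRate α) * (4 ^ (l : ℕ) * (n : ℝ) ^ (-β) * (n : ℝ) ^ (-β))) := by gcongr
        _ = 4 ^ (α + 1) * Real.exp (potRate α) * (4 ^ (l : ℕ) * (n : ℝ) ^ (-β)) *
            ((n : ℝ) ^ β * (n : ℝ) ^ (-β)) := by ring
        _ = 4 ^ (α + 1) * Real.exp (potRate α) * (4 ^ (l : ℕ) * (n : ℝ) ^ (-β)) := by
            rw [hnn, mul_one]
        _ ≤ _ := by gcongr
    have hx' : x ^ U.card = Real.exp (-(β / 2 * Real.log n * (C * U.card))) := by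
      rw [hxdef, Real.rpow_def_of_pos hn', ← Real.exp_nat_mul]
      congr 1; ring
    rw [hx', Real.exp_le_exp]
    have h7 : β / 2 * Real.log n * (C * U.card) ≤ β / 2 * Real.log n * ρ U l := by gcongr
    linarith
  have hcount : (Fintype.card (Fin n × Fin L × Fin (J + 1)) : ℝ) = n * (L * (J + 1)) := by
    simp
  calc _ ≤ ((((P ×ˢ (Finset.univ : Finset (Fin (J + 1)))).biUnion bad).card : ℕ) : ℝ) := by
        exact_mod_cast Finset.card_le_card hsub
    _ ≤ ((∑ q ∈ P ×ˢ (Finset.univ : Finset (Fin (J + 1))), (bad q).card : ℕ) : ℝ) := by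
        exact_mod_cast Finset.card_biUnion_le
    _ ≤ ∑ q ∈ P ×ˢ (Finset.univ : Finset (Fin (J + 1))), (L : ℝ) ^ n * x ^ q.1.card := by
        push_cast; exact Finset.sum_le_sum hcard
    _ = (L : ℝ) ^ n * ((J + 1) * ∑ U ∈ P, x ^ U.card) := by
        rw [Finset.sum_product, ← Finset.sum_comm]
        simp [Finset.mul_sum]
        refine Finset.sum_congr rfl fun U _ => ?_
        ring
    _ ≤ _ := by
        gcongr
        have := sum_powerset_pow_le (ι := Fin n × Fin L × Fin (J + 1)) (x := x) (by positivity)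
          (by rw [hcount]; exact hx)
        rw [hcount] at this
        refine le_of_eq_of_le ?_ this
        rw [hP]
        congr!

end Peeling

section Greedy

variable {n L J : ℕ}

/-- The selected exponential polynomial with coefficients `b`. -/
def cellPoly (ω : Fin n → Fin L) (b : Fin n → ℂ) (t : ℝ) : ℂ :=
  ∑ k, b k * expo (cellFreq k (ω k)) t

/-- The triples attached to a set of cells, a selection and a level function. -/
def levelGraph (ω : Fin n → Fin L) (lev : Fin n → Fin (J + 1)) (B : Finset (Fin n)) :
    Finset (Fin n × Fin L × Fin (J + 1)) :=
  B.map ⟨fun k => (k, ω k, lev k), fun _ _ h => (Prod.ext_iff.1 h).1⟩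

lemma card_levelGraph (ω : Fin n → Fin L) (lev : Fin n → Fin (J + 1)) (B : Finset (Fin n)) :
    (levelGraph ω lev B).card = B.card := Finset.card_map _

lemma levelSum_levelGraph (ω : Fin n → Fin L) (lev : Fin n → Fin (J + 1)) (B : Finset (Fin n)) :
    levelSum (levelGraph ω lev B) = fun t =>
      ∑ k ∈ B, (((2 : ℝ)⁻¹ ^ (lev k : ℕ) : ℝ) : ℂ) * expo (cellFreq k (ω k)) t := by
  funext t
  rw [levelSum, levelGraph, Finset.sum_map]
  rfl

/-- The mass of a set of cells with respect to a level function. -/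
def levelMass (lev : Fin n → Fin (J + 1)) (B : Finset (Fin n)) : ℝ :=
  ∑ k ∈ B, (4 : ℝ)⁻¹ ^ (lev k : ℕ)

lemma levelMass_mono (lev : Fin n → Fin (J + 1)) {A B : Finset (Fin n)} (h : B ⊆ A) :
    levelMass lev B ≤ levelMass lev A :=
  Finset.sum_le_sum_of_subset_of_nonneg h fun _ _ _ => by positivity

lemma inv_four_pow (l : ℕ) : (4 : ℝ)⁻¹ ^ l = ((2 : ℝ)⁻¹ ^ l) ^ 2 := by
  rw [← pow_mul, mul_comm, pow_mul]; norm_num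

lemma exists_greedy_aux {α M β C : ℝ} (hα : 0 < α) (hM : 1 ≤ M) (hC : 0 ≤ C) {ω : Fin n → Fin L}
    (hω : Peelable α M β C J ω) (lev : Fin n → Fin (J + 1)) (A : Finset (Fin n))
    (hA : levelMass lev A ≤ 1) (m : ℕ) (hm : m ≤ J + 1) :
    ∃ B ⊆ A, (∀ k ∈ B, (lev k : ℕ) < m) ∧
      1 + potInt α M (levelSum (levelGraph ω lev B)) ≤ Real.exp (potRate α * levelMass lev B) ∧
      ∀ l : Fin (J + 1), (l : ℕ) < m → ((A.filter (lev · = l)).card : ℝ) ≤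
        (B.filter (lev · = l)).card + C * (B.filter (lev · ≤ l)).card +
          4 ^ (l : ℕ) * (n : ℝ) ^ (-β) := by
  classical
  induction m with
  | zero =>
    refine ⟨∅, Finset.empty_subset _, by simp, ?_, by simp⟩
    have h1 : levelSum (levelGraph ω lev ∅) = fun _ => 0 := by
      rw [levelSum_levelGraph]; simp
    rw [h1]
    simp [levelMass, potInt, truncPot]
  | succ m ih =>
    obtain ⟨B, hBA, hBm, hBinv, hBl⟩ := ih (by omega)
    set lm : Fin (J + 1) := ⟨m, by omega⟩ with hlm
    set Inv : Finset (Fin n) → Prop := fun D =>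
      1 + potInt α M (levelSum (levelGraph ω lev (B ∪ D))) ≤
        Real.exp (potRate α * levelMass lev (B ∪ D)) with hInv
    obtain ⟨D, hD, hDmax⟩ := Finset.exists_max_image
      ((A.filter (lev · = lm)).powerset.filter Inv) Finset.card
      ⟨∅, Finset.mem_filter.2 ⟨Finset.empty_mem_powerset _, by
        simp only [hInv, Finset.union_empty]; exact hBinv⟩⟩
    obtain ⟨hDA, hDinv⟩ := Finset.mem_filter.1 hD
    rw [Finset.mem_powerset] at hDA
    have hDA' : D ⊆ A := hDA.trans (Finset.filter_subset _ _)
    have hBD : B ∪ D ⊆ A := Finset.union_subset hBA hDA'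
    have hlevD : ∀ k ∈ D, lev k = lm := fun k hk => (Finset.mem_filter.1 (hDA hk)).2
    have hlt : ∀ k ∈ B ∪ D, (lev k : ℕ) < m + 1 := by
      intro k hk
      rcases Finset.mem_union.1 hk with h | h
      · exact (hBm k h).trans (Nat.lt_succ_self _)
      · rw [hlevD k h]; simp [hlm]
    refine ⟨B ∪ D, hBD, hlt, hDinv, fun l hl => ?_⟩
    rcases Nat.lt_succ_iff_lt_or_eq.1 hl with hl | hl
    · refine (hBl l hl).trans ?_
      have h1 : (B.filter (lev · = l)).card ≤ ((B ∪ D).filter (lev · = l)).card :=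
        Finset.card_le_card (Finset.filter_subset_filter _ Finset.subset_union_left)
      have h2 : (B.filter (lev · ≤ l)).card ≤ ((B ∪ D).filter (lev · ≤ l)).card :=
        Finset.card_le_card (Finset.filter_subset_filter _ Finset.subset_union_left)
      gcongr
    · have hll : l = lm := Fin.ext hl
      subst hll
      have hfil : (B ∪ D).filter (lev · ≤ lm) = B ∪ D :=
        Finset.filter_true_of_mem fun k hk => Fin.le_def.2 (Nat.lt_succ_iff.1 (hlt k hk))
      have hexp : 1 + potInt α M (levelSum (levelGraph ω lev (B ∪ D))) ≤
          Real.exp (potRate α) := by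
        refine hDinv.trans (Real.exp_le_exp.2 ?_)
        have h1 := (levelMass_mono lev hBD).trans hA
        have h2 := potRate_pos (α := α)
        nlinarith
      have hpeel := hω _ hexp lm
      rw [card_levelGraph] at hpeel
      have hhit : A.filter (lev · = lm) \ D ⊆ Finset.univ.filter fun k => (2 : ℝ)⁻¹ ^ (lm : ℕ) <
          ‖trigCoeff (potGrad α M (levelSum (levelGraph ω lev (B ∪ D)))) (cellFreq k (ω k))‖ := by
        intro k hk
        obtain ⟨hkA, hkD⟩ := Finset.mem_sdiff.1 hk
        refine Finset.mem_filter.2 ⟨Finset.mem_univ _, ?_⟩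
        by_contra hle
        have hkl : lev k = lm := (Finset.mem_filter.1 hkA).2
        have hkB : k ∉ B := fun h => by
          have := hBm k h
          rw [hkl] at this
          exact lt_irrefl _ this
        have hkBD : k ∉ B ∪ D := fun h => (Finset.mem_union.1 h).elim hkB hkD
        have h1 := potInt_add_expo_le hα hM (continuous_levelSum (levelGraph ω lev (B ∪ D)))
          (b := (2 : ℝ)⁻¹ ^ (lm : ℕ)) (by positivity)
          (pow_le_one₀ (by norm_num) (by norm_num)) (not_lt.1 hle)
        have h2 : (fun t => levelSum (levelGraph ω lev (B ∪ D)) t +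
            (((2 : ℝ)⁻¹ ^ (lm : ℕ) : ℝ) : ℂ) * expo (cellFreq k (ω k)) t) =
            levelSum (levelGraph ω lev (B ∪ insert k D)) := by
          rw [levelSum_levelGraph, levelSum_levelGraph, Finset.union_insert]
          funext t
          rw [Finset.sum_insert hkBD, hkl, add_comm]
        have h3 : levelMass lev (B ∪ insert k D) =
            levelMass lev (B ∪ D) + ((2 : ℝ)⁻¹ ^ (lm : ℕ)) ^ 2 := by
          unfold levelMass
          rw [Finset.union_insert, Finset.sum_insert hkBD, hkl, add_comm, inv_four_pow]
        have h4 : Inv (insert k D) := by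
          simp only [hInv]
          rw [h2] at h1
          rw [h3, mul_add, Real.exp_add]
          exact h1.trans (by gcongr)
        have h5 := hDmax (insert k D) (Finset.mem_filter.2 ⟨Finset.mem_powerset.2
          (Finset.insert_subset hkA hDA), h4⟩)
        rw [Finset.card_insert_of_notMem hkD] at h5
        omega
      have h6 : ((A.filter (lev · = lm)).card : ℝ) ≤ D.card +
          (A.filter (lev · = lm) \ D).card := by
        have := Finset.card_sdiff_add_card_eq_card hDA
        exact_mod_cast (by omega : (A.filter (lev · = lm)).card ≤
          D.card + (A.filter (lev · = lm) \ D).card)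
      have h7 : ((A.filter (lev · = lm) \ D).card : ℝ) ≤ _ :=
        (Nat.cast_le.2 (Finset.card_le_card hhit)).trans hpeel
      have h8 : (D.card : ℝ) ≤ ((B ∪ D).filter (lev · = lm)).card := by
        exact_mod_cast Finset.card_le_card fun k hk => Finset.mem_filter.2
          ⟨Finset.mem_union_right _ hk, hlevD k hk⟩
      rw [hfil]
      linarith

lemma sum_range_ite_inv_four_le (v m : ℕ) :
    ∑ l ∈ Finset.range m, (if v ≤ l then (4 : ℝ)⁻¹ ^ l else 0) ≤
      4 / 3 * ((4 : ℝ)⁻¹ ^ v - (4 : ℝ)⁻¹ ^ max v m) := by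
  induction m with
  | zero => simp
  | succ m ih =>
    rw [Finset.sum_range_succ]
    by_cases h : v ≤ m
    · rw [max_eq_right h] at ih
      rw [max_eq_right (by omega), if_pos h, pow_succ]
      linarith
    · rw [max_eq_left (by omega)] at ih ⊢
      rw [if_neg h]
      linarith

lemma exists_greedy {α M β C : ℝ} (hα : 0 < α) (hM : 1 ≤ M) (hC : 0 ≤ C) {ω : Fin n → Fin L}
    (hω : Peelable α M β C J ω) (lev : Fin n → Fin (J + 1)) (A : Finset (Fin n))
    (hA : levelMass lev A ≤ 1) :
    ∃ B ⊆ A, potInt α M (levelSum (levelGraph ω lev B)) ≤ Real.exp (potRate α) ∧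
      levelMass lev A ≤ (1 + 2 * C) * levelMass lev B + (J + 1) * (n : ℝ) ^ (-β) := by
  obtain ⟨B, hBA, -, hinv, hl⟩ := exists_greedy_aux hα hM hC hω lev A hA (J + 1) le_rfl
  refine ⟨B, hBA, ?_, ?_⟩
  · have h1 := (levelMass_mono lev hBA).trans hA
    have h2 := potRate_pos (α := α)
    have h3 : Real.exp (potRate α * levelMass lev B) ≤ Real.exp (potRate α) :=
      Real.exp_le_exp.2 (by nlinarith)
    linarith
  have hmass : ∀ D : Finset (Fin n), levelMass lev D =
      ∑ l : Fin (J + 1), (4 : ℝ)⁻¹ ^ (l : ℕ) * (D.filter (lev · = l)).card := by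
    intro D
    unfold levelMass
    rw [← Finset.sum_fiberwise D lev]
    refine Finset.sum_congr rfl fun l _ => ?_
    rw [Finset.sum_congr rfl (g := fun _ => (4 : ℝ)⁻¹ ^ (l : ℕ))
      (fun k hk => by rw [(Finset.mem_filter.1 hk).2]), Finset.sum_const, nsmul_eq_mul, mul_comm]
  have htail : ∑ l : Fin (J + 1), (4 : ℝ)⁻¹ ^ (l : ℕ) * (B.filter (lev · ≤ l)).card ≤
      2 * levelMass lev B := by
    have h1 : ∀ l : Fin (J + 1), (4 : ℝ)⁻¹ ^ (l : ℕ) * ((B.filter (lev · ≤ l)).card : ℝ) =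
        ∑ k ∈ B, if (lev k : ℕ) ≤ l then (4 : ℝ)⁻¹ ^ (l : ℕ) else 0 := by
      intro l
      rw [← Finset.sum_filter, Finset.sum_const, nsmul_eq_mul, mul_comm]
      rfl
    simp_rw [h1]
    rw [Finset.sum_comm, levelMass, Finset.mul_sum]
    refine Finset.sum_le_sum fun k _ => ?_
    rw [Fin.sum_univ_eq_sum_range (fun l => if (lev k : ℕ) ≤ l then (4 : ℝ)⁻¹ ^ l else 0)]
    refine (sum_range_ite_inv_four_le _ _).trans ?_
    have h2 : 0 ≤ (4 : ℝ)⁻¹ ^ max (lev k : ℕ) (J + 1) := by positivity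
    have h3 : 0 ≤ (4 : ℝ)⁻¹ ^ (lev k : ℕ) := by positivity
    linarith
  calc levelMass lev A = ∑ l : Fin (J + 1), (4 : ℝ)⁻¹ ^ (l : ℕ) * (A.filter (lev · = l)).card :=
        hmass A
    _ ≤ ∑ l : Fin (J + 1), (4 : ℝ)⁻¹ ^ (l : ℕ) * ((B.filter (lev · = l)).card +
          C * (B.filter (lev · ≤ l)).card + 4 ^ (l : ℕ) * (n : ℝ) ^ (-β)) :=
        Finset.sum_le_sum fun l _ => mul_le_mul_of_nonneg_left (hl l l.2) (by positivity)
    _ = ∑ l : Fin (J + 1), ((4 : ℝ)⁻¹ ^ (l : ℕ) * (B.filter (lev · = l)).card +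
          C * ((4 : ℝ)⁻¹ ^ (l : ℕ) * (B.filter (lev · ≤ l)).card) + (n : ℝ) ^ (-β)) := by
        refine Finset.sum_congr rfl fun l _ => ?_
        have : (4 : ℝ)⁻¹ ^ (l : ℕ) * 4 ^ (l : ℕ) = 1 := by
          rw [← mul_pow]; norm_num
        linear_combination (n : ℝ) ^ (-β) * this
    _ = levelMass lev B + C * (∑ l : Fin (J + 1), (4 : ℝ)⁻¹ ^ (l : ℕ) *
          (B.filter (lev · ≤ l)).card) + (J + 1) * (n : ℝ) ^ (-β) := by
        rw [Finset.sum_add_distrib, Finset.sum_add_distrib, ← hmass, ← Finset.mul_sum]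
        simp
    _ ≤ _ := by nlinarith

/-- From a nonnegative unit vector one can peel off a minorant of proportional mass and bounded
potential. -/
lemma exists_minorant {α M β C : ℝ} (hα : 0 < α) (hM : 1 ≤ M) (hC : 0 ≤ C) {ω : Fin n → Fin L}
    (hω : Peelable α M β C J ω) (hJ : 2 * (n : ℝ) ≤ 4 ^ J)
    (hJn : (J + 1) * (n : ℝ) ^ (-β) ≤ 1 / 16) {a : Fin n → ℝ} (ha : ∀ k, 0 ≤ a k)
    (ha1 : ∑ k, a k ^ 2 = 1) :
    ∃ b : Fin n → ℝ, (∀ k, 0 ≤ b k) ∧ (∀ k, b k ≤ a k) ∧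
      1 / (16 * (1 + 2 * C)) ≤ ∑ k, b k ^ 2 ∧
      potInt α M (cellPoly ω fun k => (b k : ℂ)) ≤ Real.exp (potRate α) := by
  have hak : ∀ k, a k ≤ 1 := fun k => by
    have := Finset.single_le_sum (f := fun k => a k ^ 2) (fun k _ => sq_nonneg _)
      (Finset.mem_univ k)
    rw [ha1] at this
    nlinarith [ha k]
  set A : Finset (Fin n) := Finset.univ.filter fun k => (2 : ℝ)⁻¹ ^ J < a k with hA
  have hlev : ∀ k, ∃ l : Fin (J + 1), k ∈ A →
      (2 : ℝ)⁻¹ ^ (l : ℕ) ≤ a k ∧ a k ≤ 2 * (2 : ℝ)⁻¹ ^ (l : ℕ) := by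
    intro k
    by_cases hk : k ∈ A
    swap
    · exact ⟨0, fun h => absurd h hk⟩
    have hk' : (2 : ℝ)⁻¹ ^ J < a k := (Finset.mem_filter.1 hk).2
    obtain ⟨i, h1, h2⟩ := exists_nat_pow_near_of_lt_one (lt_of_le_of_lt (by positivity) hk')
      (hak k) (by norm_num : (0 : ℝ) < 2⁻¹) (by norm_num)
    have hi : i < J := (pow_lt_pow_iff_right_of_lt_one₀ (by norm_num) (by norm_num)).1
      (hk'.trans_le h2)
    refine ⟨⟨i + 1, by omega⟩, fun _ => ⟨h1.le, h2.trans (le_of_eq ?_)⟩⟩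
    simp only [pow_succ]; ring
  choose lev hlev using hlev
  have hlow : levelMass lev A ≤ 1 := by
    rw [← ha1]
    refine le_trans (Finset.sum_le_sum fun k hk => ?_)
      (Finset.sum_le_sum_of_subset_of_nonneg (Finset.subset_univ A) fun k _ _ => sq_nonneg (a k))
    rw [inv_four_pow]
    have := (hlev k hk).1
    gcongr
  have hup : 1 / 8 ≤ levelMass lev A := by
    have h1 : ∑ k ∈ A, a k ^ 2 ≤ 4 * levelMass lev A := by
      unfold levelMass
      rw [Finset.mul_sum]
      refine Finset.sum_le_sum fun k hk => ?_
      rw [inv_four_pow]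
      have := (hlev k hk).2
      have h0 := ha k
      calc a k ^ 2 ≤ (2 * (2 : ℝ)⁻¹ ^ (lev k : ℕ)) ^ 2 := by gcongr
        _ = _ := by ring
    have h2 : ∑ k ∈ Finset.univ.filter (fun k => ¬ (2 : ℝ)⁻¹ ^ J < a k), a k ^ 2 ≤ 1 / 2 := by
      calc _ ≤ ∑ _k ∈ Finset.univ.filter (fun k => ¬ (2 : ℝ)⁻¹ ^ J < a k), (4 : ℝ)⁻¹ ^ J := by
            refine Finset.sum_le_sum fun k hk => ?_
            rw [inv_four_pow]
            have h3 := not_lt.1 (Finset.mem_filter.1 hk).2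
            have h0 := ha k
            gcongr
        _ ≤ ∑ _k : Fin n, (4 : ℝ)⁻¹ ^ J :=
            Finset.sum_le_sum_of_subset_of_nonneg (Finset.subset_univ _) fun _ _ _ => by positivity
        _ = n / 4 ^ J := by simp [div_eq_mul_inv]
        _ ≤ _ := by rw [div_le_iff₀ (by positivity)]; linarith
    have h3 := Finset.sum_filter_add_sum_filter_not Finset.univ
      (fun k => (2 : ℝ)⁻¹ ^ J < a k) (fun k => a k ^ 2)
    rw [ha1, ← hA] at h3
    linarith
  obtain ⟨B, hBA, hpot, hmass⟩ := exists_greedy hα hM hC hω lev A hlow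
  refine ⟨fun k => if k ∈ B then (2 : ℝ)⁻¹ ^ (lev k : ℕ) else 0, fun k => ?_, fun k => ?_, ?_, ?_⟩
  · dsimp only; split_ifs <;> positivity
  · dsimp only; split_ifs with h
    · exact (hlev k (hBA h)).1
    · exact ha k
  · have h1 : ∑ k, (if k ∈ B then (2 : ℝ)⁻¹ ^ (lev k : ℕ) else 0) ^ 2 = levelMass lev B := by
      unfold levelMass
      simp_rw [inv_four_pow]
      simp [ite_pow]
    rw [h1, div_le_iff₀ (by positivity)]
    nlinarith
  · have h1 : (cellPoly ω fun k => (((if k ∈ B then (2 : ℝ)⁻¹ ^ (lev k : ℕ) else 0 : ℝ)) : ℂ)) =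
        levelSum (levelGraph ω lev B) := by
      rw [levelSum_levelGraph]
      funext t
      unfold cellPoly
      rw [← Finset.sum_filter_add_sum_filter_not Finset.univ (· ∈ B)]
      rw [Finset.sum_congr rfl (g := fun k => (((2 : ℝ)⁻¹ ^ (lev k : ℕ) : ℝ) : ℂ) *
        expo (cellFreq k (ω k)) t) (fun k hk => by simp only [if_pos (Finset.mem_filter.1 hk).2]),
        Finset.sum_eq_zero (s := Finset.univ.filter (· ∉ B)) (fun k hk => by
          simp [(Finset.mem_filter.1 hk).2])]
      simp
    rw [h1]; exact hpot

lemma cellFreq_selection_injective (ω : Fin n → Fin L) :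
    Function.Injective fun k => cellFreq k (ω k) := fun k k' h =>
  (Prod.ext_iff.1 (cellFreq_injective (a₁ := (k, ω k)) (a₂ := (k', ω k')) h)).1

lemma integral_cellPoly_rpow_le {α B : ℝ} (hα : 0 < α) (hB : 1 ≤ B) (hL : 0 < L)
    (hnL : (n : ℝ) ^ α ≤ 2 * L) {ω : Fin n → Fin L} (hω : ∀ θ, ‖cellDisc ω θ‖ ≤ B) {b : Fin n → ℂ}
    (hb : ∑ k, ‖b k‖ ^ 2 ≤ 1) :
    ∫ t in (0 : ℝ)..1, ‖cellPoly ω b t‖ ^ (2 + 2 * α) ≤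
      4 + 2 ^ (α + 1) * potInt α (2 * B) (cellPoly ω b) := by
  have hL' : (0 : ℝ) < L := by exact_mod_cast hL
  set e : Fin n ↪ ℤ := ⟨fun k => cellFreq k (ω k), cellFreq_selection_injective ω⟩ with he
  set e' : Fin n × Fin L ↪ ℤ := ⟨fun x => cellFreq x.1 x.2, cellFreq_injective⟩ with he'
  set S : Finset ℤ := Finset.univ.map e with hS
  set T : Finset ℤ := Finset.univ.map e' with hT
  set a : ℤ → ℂ := Function.extend e b 0 with ha
  have hae : ∀ k, a (e k) = b k := fun k => e.injective.extend_apply _ _ _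
  have h1 : ∀ t, ∑ x ∈ S, a x * expo x t = cellPoly ω b t := fun t => by
    rw [hS, Finset.sum_map]
    exact Finset.sum_congr rfl fun k _ => by rw [hae]; rfl
  have h2 := integral_norm_rpow_le (S := S) (T := T) (δ := 1 / L) (K := 2) hα (by positivity) hB
    (by
      rw [hS, Finset.card_map, Finset.card_univ, Fintype.card_fin, div_mul_eq_mul_div, one_mul,
        div_le_iff₀ hL']
      exact hnL)
    (fun θ => by
      refine le_of_eq_of_le ?_ (hω θ)
      rw [hS, hT, Finset.sum_map, Finset.sum_map, cellDisc, Finset.sum_sub_distrib,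
        ← Finset.mul_sum, Fintype.sum_prod_type]
      rfl)
    (a := a) (by
      rw [hS, Finset.sum_map]
      simp_rw [hae]
      exact hb)
  simp_rw [h1] at h2
  refine h2.trans (le_of_eq ?_)
  norm_num

end Greedy

section UnitNorm

/-- The `L^p` norm over the unit interval. -/
def unitNorm (p : ℝ) (f : ℝ → ℂ) : ℝ := (∫ t in (0 : ℝ)..1, ‖f t‖ ^ p) ^ (1 / p)

variable {p : ℝ} {f g : ℝ → ℂ}

lemma memLp_unit (hf : Continuous f) (q : ENNReal) : MemLp f q (volume.restrict (Ioc (0 : ℝ) 1)) := by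
  obtain ⟨C, hC⟩ := isCompact_Icc.exists_bound_of_continuousOn (s := Icc (0 : ℝ) 1) hf.continuousOn
  exact MemLp.of_bound hf.aestronglyMeasurable C
    (ae_restrict_of_forall_mem measurableSet_Ioc fun x hx => hC x (Ioc_subset_Icc_self hx))

lemma eLpNorm_unit (hp : 0 < p) (hf : Continuous f) :
    eLpNorm f (ENNReal.ofReal p) (volume.restrict (Ioc (0 : ℝ) 1)) =
      ENNReal.ofReal (unitNorm p f) := by
  rw [(memLp_unit hf _).eLpNorm_eq_integral_rpow_norm (by simpa using hp) ENNReal.ofReal_ne_top,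
    ENNReal.toReal_ofReal hp.le, unitNorm, intervalIntegral.integral_of_le zero_le_one, one_div]

lemma unitNorm_nonneg (f : ℝ → ℂ) : 0 ≤ unitNorm p f :=
  Real.rpow_nonneg (intervalIntegral.integral_nonneg zero_le_one fun _ _ => by positivity) _

lemma unitNorm_add_le (hp : 1 ≤ p) (hf : Continuous f) (hg : Continuous g) :
    unitNorm p (fun t => f t + g t) ≤ unitNorm p f + unitNorm p g := by
  have hp0 : 0 < p := by linarith
  have h := eLpNorm_add_le (p := ENNReal.ofReal p)
    (hf.aestronglyMeasurable (μ := volume.restrict (Ioc (0 : ℝ) 1)))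
    hg.aestronglyMeasurable (by simpa using hp)
  rw [eLpNorm_unit hp0 hf, eLpNorm_unit hp0 hg, eLpNorm_unit hp0 (hf.add hg),
    ← ENNReal.ofReal_add (unitNorm_nonneg f) (unitNorm_nonneg g)] at h
  exact (ENNReal.ofReal_le_ofReal_iff (add_nonneg (unitNorm_nonneg f) (unitNorm_nonneg g))).1 h

lemma unitNorm_const_mul (hp : 0 < p) (c : ℂ) (f : ℝ → ℂ) :
    unitNorm p (fun t => c * f t) = ‖c‖ * unitNorm p f := by
  unfold unitNorm
  simp_rw [norm_mul, Real.mul_rpow (norm_nonneg c) (norm_nonneg _)]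
  rw [intervalIntegral.integral_const_mul, Real.mul_rpow (by positivity)
    (intervalIntegral.integral_nonneg zero_le_one fun _ _ => by positivity), ← Real.rpow_mul
    (norm_nonneg c), mul_one_div_cancel hp.ne', Real.rpow_one]

lemma unitNorm_le_of_bound (hp : 0 < p) (hf : Continuous f) {K : ℝ} (hK : ∀ t, ‖f t‖ ≤ K) :
    unitNorm p f ≤ K := by
  have hK0 : 0 ≤ K := (norm_nonneg _).trans (hK 0)
  have hr : Continuous fun t => ‖f t‖ ^ p := (Real.continuous_rpow_const hp.le).comp hf.norm
  have h : ∫ t in (0 : ℝ)..1, ‖f t‖ ^ p ≤ K ^ p := by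
    have := intervalIntegral.integral_mono_on (μ := volume) zero_le_one (hr.intervalIntegrable 0 1)
      ((continuous_const (y := K ^ p)).intervalIntegrable 0 1) fun t _ =>
        Real.rpow_le_rpow (norm_nonneg _) (hK t) hp.le
    simpa using this
  calc unitNorm p f ≤ (K ^ p) ^ (1 / p) := Real.rpow_le_rpow
        (intervalIntegral.integral_nonneg zero_le_one fun _ _ => by positivity) h (by positivity)
    _ = K := by rw [← Real.rpow_mul hK0, mul_one_div_cancel hp.ne', Real.rpow_one]

end UnitNorm

section Iteration

variable {n L : ℕ} {p : ℝ}

lemma continuous_cellPoly (ω : Fin n → Fin L) (a : Fin n → ℂ) : Continuous (cellPoly ω a) := by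
  have := continuous_expo
  unfold cellPoly; fun_prop

lemma cellPoly_add (ω : Fin n → Fin L) (a b : Fin n → ℂ) :
    cellPoly ω (fun k => a k + b k) = fun t => cellPoly ω a t + cellPoly ω b t := by
  funext t
  simp only [cellPoly, add_mul, Finset.sum_add_distrib]

lemma cellPoly_const_mul (ω : Fin n → Fin L) (c : ℂ) (a : Fin n → ℂ) :
    cellPoly ω (fun k => c * a k) = fun t => c * cellPoly ω a t := by
  funext t
  simp only [cellPoly, mul_assoc, Finset.mul_sum]

lemma norm_cellPoly_le (ω : Fin n → Fin L) (a : Fin n → ℂ) {τ : ℝ} (hτ : 0 ≤ τ)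
    (ha : ∑ k, ‖a k‖ ^ 2 ≤ τ ^ 2) (t : ℝ) : ‖cellPoly ω a t‖ ≤ τ * Real.sqrt n := by
  have h1 : ‖cellPoly ω a t‖ ≤ ∑ k, ‖a k‖ * 1 := by
    refine (norm_sum_le _ _).trans (le_of_eq ?_)
    exact Finset.sum_congr rfl fun k _ => by rw [norm_mul, norm_expo]
  refine h1.trans ?_
  have h2 : (∑ k, ‖a k‖ * 1) ^ 2 ≤ (∑ k, ‖a k‖ ^ 2) * ∑ _k : Fin n, (1 : ℝ) ^ 2 :=
    Finset.sum_mul_sq_le_sq_mul_sq _ _ _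
  have h3 : ∑ _k : Fin n, (1 : ℝ) ^ 2 = n := by simp
  rw [h3] at h2
  refine abs_le_of_sq_le_sq' ?_ (by positivity) |>.2
  rw [mul_pow, Real.sq_sqrt (Nat.cast_nonneg n)]
  exact h2.trans (by gcongr)

lemma unitNorm_cellPoly_iterate (hp : 1 ≤ p) {ω : Fin n → Fin L} {θ Q : ℝ} (hθ : 0 < θ)
    (hθ1 : θ ≤ 1) (hQ : 0 ≤ Q)
    (H : ∀ a : Fin n → ℝ, (∀ k, 0 ≤ a k) → ∑ k, a k ^ 2 = 1 → ∃ b : Fin n → ℝ,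
      (∀ k, 0 ≤ b k) ∧ (∀ k, b k ≤ a k) ∧ θ ≤ ∑ k, b k ^ 2 ∧
        unitNorm p (cellPoly ω fun k => (b k : ℂ)) ≤ Q) (m : ℕ) :
    ∀ (a : Fin n → ℝ) (τ : ℝ), (∀ k, 0 ≤ a k) → 0 ≤ τ → ∑ k, a k ^ 2 ≤ τ ^ 2 →
      unitNorm p (cellPoly ω fun k => (a k : ℂ)) ≤
        τ * (Q / (1 - Real.sqrt (1 - θ)) + Real.sqrt (1 - θ) ^ m * Real.sqrt n) := by
  have hp0 : 0 < p := by linarith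
  set r := Real.sqrt (1 - θ) with hr
  have hr0 : 0 ≤ r := Real.sqrt_nonneg _
  have hr2 : r ^ 2 = 1 - θ := Real.sq_sqrt (by linarith)
  have hr1 : r < 1 := by
    rw [hr, Real.sqrt_lt' one_pos]; linarith
  have hq : 0 ≤ Q / (1 - r) := div_nonneg hQ (by linarith)
  induction m with
  | zero =>
    intro a τ ha hτ hs
    refine (unitNorm_le_of_bound hp0 (continuous_cellPoly _ _)
      (norm_cellPoly_le ω _ hτ (by simpa using hs))).trans ?_
    rw [pow_zero, one_mul]
    gcongr
    linarith
  | succ m ih =>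
    intro a τ ha hτ hs
    have hfac : 0 ≤ Q / (1 - r) + r ^ (m + 1) * Real.sqrt n := by positivity
    set σ := Real.sqrt (∑ k, a k ^ 2) with hσ
    have hσ0 : 0 ≤ σ := Real.sqrt_nonneg _
    have hσ2 : σ ^ 2 = ∑ k, a k ^ 2 := Real.sq_sqrt (Finset.sum_nonneg fun k _ => sq_nonneg _)
    have hστ : σ ≤ τ := Real.sqrt_le_iff.2 ⟨hτ, hs⟩
    suffices h : unitNorm p (cellPoly ω fun k => (a k : ℂ)) ≤
        σ * (Q / (1 - r) + r ^ (m + 1) * Real.sqrt n) from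
      h.trans (mul_le_mul_of_nonneg_right hστ hfac)
    rcases hσ0.eq_or_lt with h0 | hpos
    · rw [← h0, zero_mul]
      refine unitNorm_le_of_bound hp0 (continuous_cellPoly _ _) fun t => ?_
      have := norm_cellPoly_le ω (fun k => (a k : ℂ)) le_rfl
        (by simp only [Complex.norm_real, Real.norm_eq_abs, sq_abs]; rw [← hσ2, ← h0]) t
      simpa using this
    obtain ⟨b, hb0, hba, hbθ, hbQ⟩ := H (fun k => a k / σ) (fun k => div_nonneg (ha k) hσ0) (by
      simp_rw [div_pow]
      rw [← Finset.sum_div, ← hσ2, div_self (by positivity)])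
    have hba' : ∀ k, σ * b k ≤ a k := fun k => by
      have := hba k
      rw [le_div_iff₀ hpos] at this
      linarith
    have hc := ih (fun k => a k - σ * b k) (σ * r) (fun k => by linarith [hba' k])
      (by positivity) (by
        have h1 : ∀ k, (a k - σ * b k) ^ 2 ≤ a k ^ 2 - σ ^ 2 * b k ^ 2 := fun k => by
          nlinarith [mul_nonneg (mul_nonneg hσ0 (hb0 k)) (sub_nonneg.2 (hba' k))]
        refine (Finset.sum_le_sum fun k _ => h1 k).trans ?_
        rw [Finset.sum_sub_distrib, ← Finset.mul_sum, ← hσ2, mul_pow, hr2]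
        nlinarith [sq_nonneg σ])
    have hsplit : cellPoly ω (fun k => (a k : ℂ)) = fun t =>
        cellPoly ω (fun k => (σ : ℂ) * (b k : ℂ)) t +
          cellPoly ω (fun k => ((a k - σ * b k : ℝ) : ℂ)) t := by
      rw [← cellPoly_add]
      congr 1; funext k; push_cast; ring
    have h2 : unitNorm p (cellPoly ω fun k => (σ : ℂ) * (b k : ℂ)) ≤ σ * Q := by
      rw [cellPoly_const_mul, unitNorm_const_mul hp0, Complex.norm_real, Real.norm_of_nonneg hσ0]
      gcongr
    rw [hsplit]
    refine (unitNorm_add_le hp (continuous_cellPoly _ _) (continuous_cellPoly _ _)).trans ?_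
    refine (add_le_add h2 hc).trans (le_of_eq ?_)
    have h3 : (1 - r) ≠ 0 := by linarith
    field_simp
    ring

lemma unitNorm_cellPoly_le_of_minorant (hp : 1 ≤ p) {ω : Fin n → Fin L} {θ Q : ℝ} (hθ : 0 < θ)
    (hθ1 : θ ≤ 1) (hQ : 0 ≤ Q)
    (H : ∀ a : Fin n → ℝ, (∀ k, 0 ≤ a k) → ∑ k, a k ^ 2 = 1 → ∃ b : Fin n → ℝ,
      (∀ k, 0 ≤ b k) ∧ (∀ k, b k ≤ a k) ∧ θ ≤ ∑ k, b k ^ 2 ∧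
        unitNorm p (cellPoly ω fun k => (b k : ℂ)) ≤ Q) (a : Fin n → ℂ) :
    unitNorm p (cellPoly ω a) ≤
      4 * (Q / (1 - Real.sqrt (1 - θ))) * Real.sqrt (∑ k, ‖a k‖ ^ 2) := by
  have hp0 : 0 < p := by linarith
  set r := Real.sqrt (1 - θ) with hr
  have hr0 : 0 ≤ r := Real.sqrt_nonneg _
  have hr1 : r < 1 := by
    rw [hr, Real.sqrt_lt' one_pos]; linarith
  set τ := Real.sqrt (∑ k, ‖a k‖ ^ 2) with hτ
  have hτ0 : 0 ≤ τ := Real.sqrt_nonneg _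
  have hτ2 : τ ^ 2 = ∑ k, ‖a k‖ ^ 2 := Real.sq_sqrt (Finset.sum_nonneg fun k _ => sq_nonneg _)
  have key : ∀ (u : ℂ) (b : Fin n → ℝ), ‖u‖ = 1 → (∀ k, 0 ≤ b k) → (∀ k, b k ≤ ‖a k‖) →
      unitNorm p (cellPoly ω fun k => u * (b k : ℂ)) ≤ τ * (Q / (1 - r)) := by
    intro u b hu hb hba
    rw [cellPoly_const_mul, unitNorm_const_mul hp0, hu, one_mul]
    have hb2 : ∑ k, b k ^ 2 ≤ τ ^ 2 := by
      rw [hτ2]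
      refine Finset.sum_le_sum fun k _ => ?_
      have h1 := hb k
      have h2 := hba k
      gcongr
    have hlim : Filter.Tendsto (fun m : ℕ => τ * (Q / (1 - r) + r ^ m * Real.sqrt n)) Filter.atTop
        (nhds (τ * (Q / (1 - r) + 0 * Real.sqrt n))) :=
      (((tendsto_pow_atTop_nhds_zero_of_lt_one hr0 hr1).mul_const _).const_add _).const_mul _
    rw [zero_mul, add_zero] at hlim
    exact ge_of_tendsto' hlim fun m => unitNorm_cellPoly_iterate hp hθ hθ1 hQ H m b τ hb hτ0 hb2
  have hre : ∀ k, |(a k).re| ≤ ‖a k‖ := fun k => Complex.abs_re_le_norm _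
  have him : ∀ k, |(a k).im| ≤ ‖a k‖ := fun k => Complex.abs_im_le_norm _
  have hsplit : cellPoly ω a = fun t =>
      (cellPoly ω (fun k => 1 * ((max (a k).re 0 : ℝ) : ℂ)) t +
        cellPoly ω (fun k => (-1) * ((max (-(a k).re) 0 : ℝ) : ℂ)) t) +
      (cellPoly ω (fun k => Complex.I * ((max (a k).im 0 : ℝ) : ℂ)) t +
        cellPoly ω (fun k => (-Complex.I) * ((max (-(a k).im) 0 : ℝ) : ℂ)) t) := by
    funext t
    simp only [cellPoly, ← Finset.sum_add_distrib, ← add_mul]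
    refine Finset.sum_congr rfl fun k _ => ?_
    congr 1
    have h1 : ∀ x : ℝ, x = max x 0 - max (-x) 0 := fun x => by
      rw [max_zero_sub_eq_self]
    have h2 : ((a k).re : ℂ) = ((max (a k).re 0 : ℝ) : ℂ) - ((max (-(a k).re) 0 : ℝ) : ℂ) := by
      rw [← Complex.ofReal_sub, ← h1]
    have h3 : ((a k).im : ℂ) = ((max (a k).im 0 : ℝ) : ℂ) - ((max (-(a k).im) 0 : ℝ) : ℂ) := by
      rw [← Complex.ofReal_sub, ← h1]
    conv_lhs => rw [← Complex.re_add_im (a k), h2, h3]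
    ring
  have hb : ∀ x y : ℝ, |x| ≤ y → max x 0 ≤ y ∧ max (-x) 0 ≤ y := fun x y h =>
    ⟨max_le ((le_abs_self x).trans h) ((abs_nonneg x).trans h),
      max_le ((neg_le_abs x).trans h) ((abs_nonneg x).trans h)⟩
  have k1 := key 1 (fun k => max (a k).re 0) (by simp) (fun k => le_max_right _ _)
    fun k => (hb _ _ (hre k)).1
  have k2 := key (-1) (fun k => max (-(a k).re) 0) (by simp) (fun k => le_max_right _ _)
    fun k => (hb _ _ (hre k)).2
  have k3 := key Complex.I (fun k => max (a k).im 0) (by simp) (fun k => le_max_right _ _)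
    fun k => (hb _ _ (him k)).1
  have k4 := key (-Complex.I) (fun k => max (-(a k).im) 0) (by simp) (fun k => le_max_right _ _)
    fun k => (hb _ _ (him k)).2
  have hc := continuous_cellPoly (n := n) ω
  rw [hsplit]
  refine (unitNorm_add_le hp ((hc _).add (hc _)) ((hc _).add (hc _))).trans ?_
  have s1 := unitNorm_add_le hp (hc fun k => 1 * ((max (a k).re 0 : ℝ) : ℂ))
    (hc fun k => (-1) * ((max (-(a k).re) 0 : ℝ) : ℂ))
  have s2 := unitNorm_add_le hp (hc fun k => Complex.I * ((max (a k).im 0 : ℝ) : ℂ))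
    (hc fun k => (-Complex.I) * ((max (-(a k).im) 0 : ℝ) : ℂ))
  refine (add_le_add s1 s2).trans ?_
  linarith

end Iteration

section Selection

open Filter

lemma log_two_gt_half : (1 : ℝ) / 2 < Real.log 2 := by linarith [Real.log_two_gt_d9]

lemma natLog_two_le {n : ℕ} (hn : 0 < n) : (Nat.log 2 n : ℝ) ≤ 2 * Real.log n := by
  have h1 : ((2 : ℝ) ^ Nat.log 2 n) ≤ n := by exact_mod_cast Nat.pow_log_le_self 2 hn.ne'
  have h2 := Real.log_le_log (by positivity) h1
  rw [Real.log_pow] at h2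
  have h3 : (0 : ℝ) ≤ Nat.log 2 n := Nat.cast_nonneg _
  nlinarith [log_two_gt_half]

lemma eventually_log_mul_rpow_neg_le {β : ℝ} (hβ : 0 < β) :
    ∀ᶠ n : ℕ in atTop, ((Nat.log 2 n + 1 : ℕ) + 1 : ℝ) * (n : ℝ) ^ (-β) ≤ 1 / 16 := by
  have h1 : Tendsto (fun x : ℝ => Real.log x / x ^ β) atTop (nhds 0) :=
    (isLittleO_log_rpow_atTop hβ).tendsto_div_nhds_zero
  have h2 : Tendsto (fun x : ℝ => x ^ (-β)) atTop (nhds 0) := tendsto_rpow_neg_atTop hβ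
  have h3 : Tendsto (fun x : ℝ => 2 * (Real.log x / x ^ β) + 2 * x ^ (-β)) atTop (nhds 0) := by
    simpa using (h1.const_mul 2).add (h2.const_mul 2)
  filter_upwards [(h3.comp tendsto_natCast_atTop_atTop).eventually_le_const
    (by norm_num : (0 : ℝ) < 1 / 16), eventually_gt_atTop 0] with n hn hn0
  refine le_trans ?_ hn
  have hn' : (0 : ℝ) < n := by exact_mod_cast hn0
  have h4 := natLog_two_le hn0
  simp only [Function.comp]
  rw [div_eq_mul_inv, ← Real.rpow_neg hn'.le, ← mul_assoc, ← add_mul]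
  push_cast
  refine mul_le_mul_of_nonneg_right ?_ (by positivity)
  linarith

lemma eventually_rpow_mul_exp_neg_lt (q : ℝ) :
    ∀ᶠ n : ℕ in atTop, 128 * (n : ℝ) ^ q * Real.exp (-((n : ℝ) ^ (1 / 2 : ℝ) / 256)) < 1 / 2 := by
  have h1 := tendsto_rpow_mul_exp_neg_mul_atTop_nhds_zero (2 * q) (1 / 256) (by norm_num)
  have h2 := (h1.comp (tendsto_rpow_atTop (by norm_num : (0 : ℝ) < 1 / 2))).comp
    tendsto_natCast_atTop_atTop
  have h3 := h2.const_mul 128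
  rw [mul_zero] at h3
  filter_upwards [h3.eventually_lt_const (by norm_num : (0 : ℝ) < 1 / 2)] with n hn
  refine lt_of_eq_of_lt ?_ hn
  simp only [Function.comp]
  rw [← Real.rpow_mul (Nat.cast_nonneg n), mul_assoc]
  congr 3
  · ring
  · ring_nf

/-- In every sufficiently long array of cells, one frequency can be selected from each cell so that
the selected frequencies satisfy a uniform `Λ(p)` bound. -/
lemma exists_selection {p : ℝ} (hp : 2 < p) : ∃ C : ℝ, 0 < C ∧ ∀ᶠ n : ℕ in atTop, ∀ L : ℕ, 0 < L →
    (n : ℝ) ^ ((p - 2) / 2) ≤ 2 * L → (L : ℝ) ≤ (n : ℝ) ^ p → ∃ ω : Fin n → Fin L,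
      ∀ a : Fin n → ℂ, unitNorm p (cellPoly ω a) ≤ C * Real.sqrt (∑ k, ‖a k‖ ^ 2) := by
  classical
  obtain ⟨α, hαdef⟩ : ∃ α : ℝ, α = (p - 2) / 2 := ⟨_, rfl⟩
  have hα : 0 < α := by rw [hαdef]; linarith
  obtain ⟨β, hβ⟩ : ∃ β : ℝ, β = α / 8 := ⟨_, rfl⟩
  have hβ0 : 0 < β := by rw [hβ]; positivity
  obtain ⟨C, hC⟩ : ∃ C : ℝ, C = 2 * (p + 4) / β := ⟨_, rfl⟩
  have hC0 : 0 ≤ C := by rw [hC]; positivity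
  have hβC : β / 2 * C = p + 4 := by rw [hC]; field_simp
  obtain ⟨θ, hθ⟩ : ∃ θ : ℝ, θ = 1 / (16 * (1 + 2 * C)) := ⟨_, rfl⟩
  have hθ0 : 0 < θ := by rw [hθ]; positivity
  have hθ1 : θ ≤ 1 := by
    rw [hθ, div_le_one (by positivity)]; linarith
  obtain ⟨Q, hQ⟩ : ∃ Q : ℝ,
    Q = (4 + 2 ^ (α + 1) * Real.exp (potRate α)) ^ (1 / p) := ⟨_, rfl⟩
  have hQ0 : 0 < Q := by rw [hQ]; positivity
  have hr1 : 0 < 1 - Real.sqrt (1 - θ) := by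
    rw [sub_pos, Real.sqrt_lt' one_pos]; linarith
  refine ⟨4 * (Q / (1 - Real.sqrt (1 - θ))), by positivity, ?_⟩
  have hlog : ∀ᶠ n : ℕ in atTop, 2 * (4 ^ (α + 1) * Real.exp (potRate α)) / β ≤ Real.log n :=
    (Real.tendsto_log_atTop.comp tendsto_natCast_atTop_atTop).eventually_ge_atTop _
  filter_upwards [eventually_log_mul_rpow_neg_le hβ0, eventually_rpow_mul_exp_neg_lt (2 + p), hlog,
    eventually_ge_atTop 37] with n h1 h2 h3 h37 L hL hnL hLn
  rw [← hαdef] at hnL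
  have hn : 0 < n := by omega
  have hn' : (0 : ℝ) < n := by exact_mod_cast hn
  have hn37 : (37 : ℝ) ≤ n := by exact_mod_cast h37
  have hL' : (0 : ℝ) < L := by exact_mod_cast hL
  have hLn0 : (0 : ℝ) < (L : ℝ) ^ n := by positivity
  set J : ℕ := Nat.log 2 n + 1 with hJ
  have hJ3 : ((J : ℝ) + 1) ≤ 3 * n := by
    have : J + 1 ≤ 3 * n := by
      have := Nat.log_le_self 2 n
      omega
    exact_mod_cast this
  have hmx : (n * (L * ((J : ℝ) + 1))) * (n : ℝ) ^ (-(β / 2 * C)) ≤ 3 / n ^ 2 := by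
    rw [hβC]
    calc (n * (L * ((J : ℝ) + 1))) * (n : ℝ) ^ (-(p + 4)) ≤
        (n * ((n : ℝ) ^ p * (3 * n))) * (n : ℝ) ^ (-(p + 4)) := by gcongr
      _ = 3 * n ^ 2 * ((n : ℝ) ^ p * (n : ℝ) ^ (-(p + 4))) := by ring
      _ = 3 * n ^ 2 * ((n : ℝ) ^ 4)⁻¹ := by
          rw [← Real.rpow_add hn', show p + -(p + 4) = -((4 : ℕ) : ℝ) by push_cast; ring,
            Real.rpow_neg hn'.le, Real.rpow_natCast]
      _ = 3 / n ^ 2 := by field_simp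
  have hbad2 := card_not_peelable_le (J := J) hα hβ hC0 hn hL hnL
    (by rw [div_le_iff₀ hβ0] at h3; linarith)
    (hmx.trans (by rw [div_le_one (by positivity)]; nlinarith))
  have hbad2' : (L : ℝ) ^ n * (((J : ℝ) + 1) * (2 * ((n * (L * ((J : ℝ) + 1))) *
      (n : ℝ) ^ (-(β / 2 * C))))) < (L : ℝ) ^ n * (1 / 2) := by
    refine mul_lt_mul_of_pos_left ?_ hLn0
    calc _ ≤ (3 * n) * (2 * (3 / (n : ℝ) ^ 2)) := by gcongr
      _ = 18 / n := by field_simp; norm_num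
      _ < 1 / 2 := by rw [div_lt_div_iff₀ hn' two_pos]; linarith
  have hs1 : 2 * ((n : ℝ) ^ (-(1 / 4) : ℝ) / 32) ≤ 1 := by
    have := Real.rpow_le_one_of_one_le_of_nonpos (by linarith : (1 : ℝ) ≤ n)
      (by norm_num : (-(1 / 4) : ℝ) ≤ 0)
    linarith
  have hbad1 := card_cellDisc_gt_le hn hL (s := (n : ℝ) ^ (-(1 / 4) : ℝ) / 32)
    (T := (n : ℝ) ^ (3 / 4 : ℝ) / 4) (by positivity) hs1
  have hexp : 4 * (n : ℝ) * ((n : ℝ) ^ (-(1 / 4) : ℝ) / 32) ^ 2 -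
      (n : ℝ) ^ (-(1 / 4) : ℝ) / 32 * ((n : ℝ) ^ (3 / 4 : ℝ) / 4) =
      -((n : ℝ) ^ (1 / 2 : ℝ) / 256) := by
    have e1 : (n : ℝ) * ((n : ℝ) ^ (-(1 / 4) : ℝ)) ^ 2 = (n : ℝ) ^ (1 / 2 : ℝ) := by
      rw [← Real.rpow_natCast, ← Real.rpow_mul hn'.le]
      nth_rewrite 1 [← Real.rpow_one (n : ℝ)]
      rw [← Real.rpow_add hn']
      norm_num
    have e2 : (n : ℝ) ^ (-(1 / 4) : ℝ) * (n : ℝ) ^ (3 / 4 : ℝ) = (n : ℝ) ^ (1 / 2 : ℝ) := by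
      rw [← Real.rpow_add hn']; norm_num
    linear_combination (1 / 256) * e1 - (1 / 128) * e2
  rw [hexp] at hbad1
  have hbad1' : (4 * (32 * (n : ℝ) ^ 2 * L)) * ((L : ℝ) ^ n *
      Real.exp (-((n : ℝ) ^ (1 / 2 : ℝ) / 256))) < (L : ℝ) ^ n * (1 / 2) := by
    calc _ ≤ (4 * (32 * (n : ℝ) ^ 2 * (n : ℝ) ^ p)) * ((L : ℝ) ^ n *
          Real.exp (-((n : ℝ) ^ (1 / 2 : ℝ) / 256))) := by gcongr
      _ = (L : ℝ) ^ n * (128 * (n : ℝ) ^ (2 + p) * Real.exp (-((n : ℝ) ^ (1 / 2 : ℝ) / 256))) := by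
          rw [Real.rpow_add hn', Real.rpow_two]; ring
      _ < _ := mul_lt_mul_of_pos_left h2 hLn0
  obtain ⟨ω, hω1, hω2⟩ : ∃ ω : Fin n → Fin L,
      (∀ θ, ‖cellDisc ω θ‖ ≤ 2 * ((n : ℝ) ^ (3 / 4 : ℝ) / 4) + 1 / 2) ∧
        Peelable α (2 * (n : ℝ) ^ (3 / 4 : ℝ)) β C J ω := by
    by_contra hcon
    push Not at hcon
    have hcov : (Finset.univ : Finset (Fin n → Fin L)) ⊆
        Finset.univ.filter (fun ω => ¬ ∀ θ, ‖cellDisc ω θ‖ ≤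
          2 * ((n : ℝ) ^ (3 / 4 : ℝ) / 4) + 1 / 2) ∪
        Finset.univ.filter (fun ω => ¬ Peelable α (2 * (n : ℝ) ^ (3 / 4 : ℝ)) β C J ω) := by
      intro ω _
      rw [Finset.mem_union, Finset.mem_filter, Finset.mem_filter]
      by_cases h : ∀ θ, ‖cellDisc ω θ‖ ≤ 2 * ((n : ℝ) ^ (3 / 4 : ℝ) / 4) + 1 / 2
      · exact Or.inr ⟨Finset.mem_univ _, hcon ω h⟩
      · exact Or.inl ⟨Finset.mem_univ _, h⟩
    have h4 : (Fintype.card (Fin n → Fin L) : ℝ) ≤ _ := Nat.cast_le.2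
      ((Finset.card_le_card hcov).trans (Finset.card_union_le _ _))
    rw [Fintype.card_fun, Fintype.card_fin, Fintype.card_fin] at h4
    push_cast at h4
    linarith
  have hn34 : (1 : ℝ) ≤ (n : ℝ) ^ (3 / 4 : ℝ) :=
    Real.one_le_rpow (by linarith) (by norm_num)
  have hdisc : ∀ θ, ‖cellDisc ω θ‖ ≤ (n : ℝ) ^ (3 / 4 : ℝ) := fun θ => by
    linarith [hω1 θ]
  have hJ4 : 2 * (n : ℝ) ≤ 4 ^ J := by
    have h5 : n < 2 ^ J := Nat.lt_pow_succ_log_self (by norm_num) n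
    have h6 : (n : ℝ) ≤ 2 ^ J := by exact_mod_cast h5.le
    have h7 : (4 : ℝ) ^ J = 2 ^ J * 2 ^ J := by rw [← mul_pow]; norm_num
    rw [h7]; nlinarith
  refine ⟨ω, fun a => unitNorm_cellPoly_le_of_minorant (by linarith) hθ0 hθ1 hQ0.le ?_ a⟩
  intro a ha ha1
  obtain ⟨b, hb0, hba, hbθ, hpot⟩ := exists_minorant hα (by linarith) hC0 hω2 hJ4 h1 ha ha1
  refine ⟨b, hb0, hba, by rw [hθ]; exact hbθ, ?_⟩
  have h8 := integral_cellPoly_rpow_le hα hn34 hL hnL hdisc (b := fun k => (b k : ℂ)) (by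
    rw [← ha1]
    refine Finset.sum_le_sum fun k _ => ?_
    rw [Complex.norm_real, Real.norm_of_nonneg (hb0 k)]
    have := hb0 k
    have := hba k
    gcongr)
  rw [show 2 + 2 * α = p by rw [hαdef]; ring] at h8
  rw [hQ, unitNorm]
  refine Real.rpow_le_rpow (intervalIntegral.integral_nonneg zero_le_one fun _ _ => by positivity)
    (h8.trans ?_) (by positivity)
  gcongr

lemma expSum_eq_cellPoly {n L : ℕ} (ω : Fin n → Fin L) (a : ℤ →₀ ℂ)
    (ha : ∀ x : ℤ, x ∉ Set.range (fun k => cellFreq k (ω k)) → a x = 0) :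
    expSum a = cellPoly ω fun k => a (cellFreq k (ω k)) := by
  funext t
  set e : Fin n ↪ ℤ := ⟨fun k => cellFreq k (ω k), cellFreq_selection_injective ω⟩ with he
  have hsub : a.support ⊆ Finset.univ.map e := fun x hx => by
    by_contra h
    refine Finsupp.mem_support_iff.1 hx (ha x fun ⟨k, hk⟩ => h ?_)
    exact Finset.mem_map.2 ⟨k, Finset.mem_univ _, hk⟩
  unfold expSum cellPoly
  rw [Finset.sum_subset hsub fun x _ hx => by rw [Finsupp.notMem_support_iff.1 hx, zero_mul],
    Finset.sum_map]
  rfl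

lemma sum_support_norm_sq {n L : ℕ} (ω : Fin n → Fin L) (a : ℤ →₀ ℂ)
    (ha : ∀ x : ℤ, x ∉ Set.range (fun k => cellFreq k (ω k)) → a x = 0) :
    ∑ x ∈ a.support, ‖a x‖ ^ 2 = ∑ k, ‖a (cellFreq k (ω k))‖ ^ 2 := by
  set e : Fin n ↪ ℤ := ⟨fun k => cellFreq k (ω k), cellFreq_selection_injective ω⟩ with he
  have hsub : a.support ⊆ Finset.univ.map e := fun x hx => by
    by_contra h
    refine Finsupp.mem_support_iff.1 hx (ha x fun ⟨k, hk⟩ => h ?_)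
    exact Finset.mem_map.2 ⟨k, Finset.mem_univ _, hk⟩
  rw [Finset.sum_subset hsub fun x _ hx => by rw [Finsupp.notMem_support_iff.1 hx]; simp,
    Finset.sum_map]
  rfl

lemma hasLambdaBound_range {n L : ℕ} {p C : ℝ} {ω : Fin n → Fin L}
    (h : ∀ a : Fin n → ℂ, unitNorm p (cellPoly ω a) ≤ C * Real.sqrt (∑ k, ‖a k‖ ^ 2)) :
    HasLambdaBound (Set.range fun k => cellFreq k (ω k)) p C := by
  intro a ha
  rw [sum_support_norm_sq ω a ha, expSum_eq_cellPoly ω a ha, ← Real.sqrt_eq_rpow,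
    integral_Icc_eq_integral_Ioc, ← intervalIntegral.integral_of_le zero_le_one]
  exact h _

end Selection

/-- **Bourgain's Λ(p) theorem.** For every `p > 2` there are constants `c_p, C_p > 0`
such that for all sufficiently large `N` there exists `S_N ⊆ {1, …, N}` with
`card(S_N) ≥ c_p N^{2/p}` and `‖S_N‖_{Λ(p)} ≤ C_p`. -/
theorem bourgain_lambda_p (p : ℝ) (hp : 2 < p) :
    ∃ c C : ℝ, 0 < c ∧ 0 < C ∧ ∃ N₀ : ℕ, ∀ N : ℕ, N₀ ≤ N →
      ∃ S : Set ℤ, S ⊆ Set.Icc 1 (N : ℤ) ∧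
        c * (N : ℝ) ^ (2 / p) ≤ (S.ncard : ℝ) ∧
        HasLambdaBound S p C := by
  obtain ⟨C, hC, hsel⟩ := exists_selection hp
  have hp0 : 0 < p := by linarith
  have hlim : Filter.Tendsto (fun N : ℕ => ⌊(N : ℝ) ^ (2 / p)⌋₊) Filter.atTop Filter.atTop :=
    tendsto_nat_floor_atTop.comp
      ((tendsto_rpow_atTop (by positivity)).comp tendsto_natCast_atTop_atTop)
  obtain ⟨N₀, hN₀⟩ := Filter.eventually_atTop.1
    (((hlim.eventually hsel).and (hlim.eventually_ge_atTop 2)).and (Filter.eventually_ge_atTop 1))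
  refine ⟨1 / 2, C, by norm_num, hC, N₀, fun N hN => ?_⟩
  obtain ⟨⟨hω, hn2⟩, hN1⟩ := hN₀ N hN
  obtain ⟨n, hn⟩ : ∃ n : ℕ, n = ⌊(N : ℝ) ^ (2 / p)⌋₊ := ⟨_, rfl⟩
  rw [← hn] at hω hn2
  have hN1' : (1 : ℝ) ≤ N := by exact_mod_cast hN1
  have hn2' : (2 : ℝ) ≤ n := by exact_mod_cast hn2
  have hn0' : (0 : ℝ) < n := by linarith
  have hn_le : (n : ℝ) ≤ (N : ℝ) ^ (2 / p) := hn ▸ Nat.floor_le (by positivity)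
  have hn_lt : (N : ℝ) ^ (2 / p) < n + 1 := hn ▸ Nat.lt_floor_add_one _
  have hnN : n ≤ N := by
    have h : (N : ℝ) ^ (2 / p) ≤ (N : ℝ) ^ (1 : ℝ) :=
      Real.rpow_le_rpow_of_exponent_le hN1' ((div_le_one hp0).2 hp.le)
    rw [Real.rpow_one] at h
    exact_mod_cast hn_le.trans h
  have hroot : ((N : ℝ) ^ (2 / p)) ^ (p / 2) = N := by
    rw [← Real.rpow_mul (by positivity), div_mul_div_cancel₀ hp0.ne', div_self two_ne_zero,
      Real.rpow_one]
  have hL0 : 0 < N / n := Nat.div_pos hnN (by omega)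
  have hLr : (1 : ℝ) ≤ (N / n : ℕ) := by exact_mod_cast hL0
  have hNlt : (N : ℝ) < n * ((N / n : ℕ) + 1) := by
    exact_mod_cast Nat.lt_mul_div_succ N (by omega : 0 < n)
  have hlow : (n : ℝ) ^ ((p - 2) / 2) ≤ 2 * (N / n : ℕ) := by
    have h : (n : ℝ) ^ (p / 2) ≤ N :=
      (Real.rpow_le_rpow hn0'.le hn_le (by positivity)).trans_eq hroot
    rw [show (p - 2) / 2 = p / 2 - 1 by ring, Real.rpow_sub_one hn0'.ne', div_le_iff₀ hn0']
    nlinarith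
  have hupp : ((N / n : ℕ) : ℝ) ≤ (n : ℝ) ^ p := by
    calc ((N / n : ℕ) : ℝ) ≤ N := by exact_mod_cast Nat.div_le_self N n
      _ = ((N : ℝ) ^ (2 / p)) ^ (p / 2) := hroot.symm
      _ ≤ ((n : ℝ) ^ (2 : ℝ)) ^ (p / 2) := by
        refine Real.rpow_le_rpow (by positivity) (hn_lt.le.trans ?_) (by positivity)
        rw [Real.rpow_two]; nlinarith
      _ = (n : ℝ) ^ p := by
        rw [← Real.rpow_mul hn0'.le, mul_div_cancel₀ p two_ne_zero]
  obtain ⟨ω, hbound⟩ := hω (N / n) hL0 hlow hupp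
  refine ⟨Set.range fun k => cellFreq k (ω k), ?_, ?_, hasLambdaBound_range hbound⟩
  · rintro _ ⟨k, rfl⟩
    refine ⟨cellFreq_pos _ _, (cellFreq_le _ _).trans ?_⟩
    exact_mod_cast Nat.mul_div_le N n
  · rw [← Set.image_univ, Set.ncard_image_of_injective _ (cellFreq_selection_injective ω),
      Set.ncard_univ, Nat.card_fin]
    linarith
end
end
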